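/- arXiv:2103.17130 — 3 statements merged into one kernel-verified Lean document; each statement's English description precedes it below -/
import Mathlib

section
/- Let φ : X → X be a quasi-finite endomorphism of an algebraic variety X over an algebraically closed field k of characteristic zero, and let Y be a proper closed subvariety of X such that φ restricted to X \ Y is injective. Then φ is an automorphism. -/
namespace QFEnd

open FirstOrder FirstOrder.Language FirstOrder.Field FirstOrder.Ring

/-- Combinatorial core: a definable injective function on a definable set is onto. -/
noncomputable def axSentence {α ι : Type} [Finite α] [Finite ι] (V : Language.ring.Formula (α ⊕ ι))
    (R : Language.ring.Formula (α ⊕ (ι ⊕ ι))) : Language.ring.Sentence :=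
  Formula.iAlls α <| Formula.relabel (Sum.inr : α → Empty ⊕ α) <|
    Formula.imp
      (Formula.iAlls ι (V.imp (Formula.iExs ι
        ((V.relabel (Sum.elim (Sum.inl ∘ Sum.inl) Sum.inr : α ⊕ ι → (α ⊕ ι) ⊕ ι)) ⊓
         (R.relabel (Sum.elim (Sum.inl ∘ Sum.inl) (Sum.elim (Sum.inl ∘ Sum.inr) Sum.inr) :
          α ⊕ (ι ⊕ ι) → (α ⊕ ι) ⊕ ι)))))) <|
    Formula.imp
      (Formula.iAlls ι (Formula.iAlls ι (Formula.iAlls ι <|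
        Formula.imp (R.relabel (Sum.elim (Sum.inl ∘ Sum.inl ∘ Sum.inl)
          (Sum.elim (Sum.inl ∘ Sum.inl ∘ Sum.inr) (Sum.inl ∘ Sum.inr)) :
            α ⊕ (ι ⊕ ι) → ((α ⊕ ι) ⊕ ι) ⊕ ι)) <|
        Formula.imp (R.relabel (Sum.elim (Sum.inl ∘ Sum.inl ∘ Sum.inl)
          (Sum.elim (Sum.inl ∘ Sum.inl ∘ Sum.inr) (Sum.inr)) :
            α ⊕ (ι ⊕ ι) → ((α ⊕ ι) ⊕ ι) ⊕ ι)) <|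
        Formula.iInf fun i : ι => Term.equal
          (Term.var (Sum.inl (Sum.inr i))) (Term.var (Sum.inr i))))) <|
    Formula.imp
      (Formula.iAlls ι (Formula.iAlls ι (Formula.iAlls ι <|
        Formula.imp (R.relabel (Sum.elim (Sum.inl ∘ Sum.inl ∘ Sum.inl)
          (Sum.elim (Sum.inl ∘ Sum.inl ∘ Sum.inr) (Sum.inr)) :
            α ⊕ (ι ⊕ ι) → ((α ⊕ ι) ⊕ ι) ⊕ ι)) <|
        Formula.imp (R.relabel (Sum.elim (Sum.inl ∘ Sum.inl ∘ Sum.inl)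
          (Sum.elim (Sum.inl ∘ Sum.inr) (Sum.inr)) :
            α ⊕ (ι ⊕ ι) → ((α ⊕ ι) ⊕ ι) ⊕ ι)) <|
        Formula.iInf fun i : ι => Term.equal
          (Term.var (Sum.inl (Sum.inl (Sum.inr i)))) (Term.var (Sum.inl (Sum.inr i)))))) <|
      (Formula.iAlls ι (V.imp (Formula.iExs ι
        ((V.relabel (Sum.elim (Sum.inl ∘ Sum.inl) Sum.inr : α ⊕ ι → (α ⊕ ι) ⊕ ι)) ⊓
         (R.relabel (Sum.elim (Sum.inl ∘ Sum.inl) (Sum.elim Sum.inr (Sum.inl ∘ Sum.inr)) :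
          α ⊕ (ι ⊕ ι) → (α ⊕ ι) ⊕ ι))))))

theorem realize_axSentence {α ι : Type} [Finite α] [Finite ι] (V : Language.ring.Formula (α ⊕ ι))
    (R : Language.ring.Formula (α ⊕ (ι ⊕ ι))) (K : Type) [Field K] [CompatibleRing K] :
    (K ⊨ axSentence V R) ↔ ∀ a : α → K,
      (∀ x, V.Realize (Sum.elim a x) → ∃ y, V.Realize (Sum.elim a y) ∧
        R.Realize (Sum.elim a (Sum.elim x y))) →
      (∀ x y z, R.Realize (Sum.elim a (Sum.elim x y)) → R.Realize (Sum.elim a (Sum.elim x z)) →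
        y = z) →
      (∀ x y z, R.Realize (Sum.elim a (Sum.elim x z)) → R.Realize (Sum.elim a (Sum.elim y z)) →
        x = y) →
      (∀ y, V.Realize (Sum.elim a y) → ∃ x, V.Realize (Sum.elim a x) ∧
        R.Realize (Sum.elim a (Sum.elim x y))) := by
  simp only [axSentence, Sentence.Realize, Formula.realize_iAlls, Formula.realize_iExs,
    Formula.realize_imp, Formula.realize_relabel, Formula.realize_inf, Formula.realize_iInf,
    Formula.realize_equal, Term.realize_var, Sum.elim_inl, Sum.elim_inr, Sum.elim_comp_inr,
    Sum.comp_elim, ← Function.comp_assoc, Sum.elim_comp_inl, funext_iff]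

theorem ax_finite {α ι : Type} [Finite α] [Finite ι] (V : Language.ring.Formula (α ⊕ ι))
    (R : Language.ring.Formula (α ⊕ (ι ⊕ ι))) (K : Type) [Field K] [CompatibleRing K]
    (hK : ∀ s : Set K, s.Finite → ∃ σ : K ≃+* K, (∀ x ∈ s, σ x = x) ∧ {x | σ x = x}.Finite) :
    K ⊨ axSentence V R := by
  rw [realize_axSentence]
  intro a h1 h2 h3 y hy
  obtain ⟨σ, hσ, hfin⟩ := hK (Set.range a ∪ Set.range y)
    ((Set.finite_range a).union (Set.finite_range y))
  let τ : K ≃[Language.ring] K := (languageEquivEquivRingEquiv (R := K) (S := K)).symm σ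
  have hτ : ∀ x, τ x = σ x := fun x => rfl
  have ha : ⇑τ ∘ a = a := by ext i; simp [hτ, hσ (a i) (by simp)]
  have hya : ⇑τ ∘ y = y := by ext i; simp [hτ, hσ (y i) (by simp)]
  let S : Set (ι → K) := {x | V.Realize (Sum.elim a x) ∧ ⇑τ ∘ x = x}
  have hS : S.Finite := by
    refine (Set.Finite.pi' (fun _ : ι => hfin)).subset ?_
    rintro x ⟨-, hx⟩ i
    exact congr_fun hx i
  choose! g hg hgR using h1
  have hRτ : ∀ x y, R.Realize (Sum.elim a (Sum.elim x y)) →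
      R.Realize (Sum.elim a (Sum.elim (⇑τ ∘ x) (⇑τ ∘ y))) := by
    intro x y h
    have := (StrongHomClass.realize_formula τ R).2 h
    rwa [Sum.comp_elim, Sum.comp_elim, ha] at this
  have hmaps : Set.MapsTo g S S := by
    rintro x ⟨hx, hx'⟩
    refine ⟨hg x hx, ?_⟩
    have := hRτ _ _ (hgR x hx)
    rw [hx'] at this
    exact h2 _ _ _ this (hgR x hx)
  have hinj : Set.InjOn g S := by
    rintro x ⟨hx, hx'⟩ z ⟨hz, hz'⟩ hxz
    refine h3 _ _ _ (hgR x hx) ?_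
    rw [hxz]; exact hgR z hz
  obtain ⟨x, hx, hxy⟩ := Finset.surjOn_of_injOn_of_card_le (s := hS.toFinset) (t := hS.toFinset) g
    (by simpa using hmaps) (by simpa using hinj) le_rfl
    (by rw [Set.Finite.coe_toFinset]; exact ⟨hy, hya⟩ : y ∈ (hS.toFinset : Set (ι → K)))
  replace hx : x ∈ S := by simpa using hx
  exact ⟨x, hx.1, hxy ▸ hgR x hx.1⟩

theorem frob_fixes (p : ℕ) [Fact p.Prime] (s : Set (AlgebraicClosure (ZMod p))) (hs : s.Finite) :
    ∃ σ : AlgebraicClosure (ZMod p) ≃+* AlgebraicClosure (ZMod p),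
      (∀ x ∈ s, σ x = x) ∧ {x | σ x = x}.Finite := by
  have key : ∀ x : AlgebraicClosure (ZMod p), ∃ n : ℕ, 0 < n ∧ ∀ m, n ∣ m → x ^ (p ^ m) = x := by
    intro x
    have hx : IsIntegral (ZMod p) x := (AlgebraicClosure.isAlgebraic (ZMod p)).isAlgebraic x |>.isIntegral
    let F := IntermediateField.adjoin (ZMod p) {x}
    have : FiniteDimensional (ZMod p) F := IntermediateField.adjoin.finiteDimensional hx
    have : Finite F := Module.finite_of_finite (ZMod p)
    have : Fintype F := Fintype.ofFinite F
    obtain ⟨n, hp, hn⟩ := FiniteField.card F p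
    refine ⟨n, n.2, ?_⟩
    rintro m ⟨c, rfl⟩
    have h := FiniteField.pow_card_pow c (⟨x, IntermediateField.mem_adjoin_simple_self _ x⟩ : F)
    rw [hn, ← pow_mul] at h
    exact congrArg Subtype.val h
  choose n hn hn' using key
  classical
  let N := ∏ x ∈ hs.toFinset, n x
  have hN : 0 < N := Finset.prod_pos fun x _ => hn x
  refine ⟨iterateFrobeniusEquiv _ p N, ?_, ?_⟩
  · intro x hx
    rw [iterateFrobeniusEquiv_def]
    exact hn' x N (Finset.dvd_prod_of_mem n (hs.mem_toFinset.2 hx))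
  · have hq : 1 < p ^ N := Nat.one_lt_pow hN.ne' (Fact.out : p.Prime).one_lt
    refine (Polynomial.finite_setOfPred_isRoot
      (p := (Polynomial.X ^ (p ^ N) - Polynomial.X : Polynomial (AlgebraicClosure (ZMod p))))
      (FiniteField.X_pow_card_sub_X_ne_zero _ hq)).subset ?_
    intro x hx
    simp only [Set.mem_ofPred_eq, iterateFrobeniusEquiv_def] at hx
    simp [hx]

theorem ax_ACF {α ι : Type} [Finite α] [Finite ι] (V : Language.ring.Formula (α ⊕ ι))
    (R : Language.ring.Formula (α ⊕ (ι ⊕ ι))) : Theory.ACF 0 ⊨ᵇ axSentence V R := by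
  rw [ACF_zero_realize_iff_infinite_ACF_prime_realize]
  convert! Set.infinite_univ (α := Nat.Primes)
  rw [Set.eq_univ_iff_forall]
  intro ⟨p, hp⟩
  have : Fact p.Prime := ⟨hp⟩
  let := compatibleRingOfRing (AlgebraicClosure (ZMod p))
  refine ((ACF_isComplete (Or.inl hp)).realize_sentence_iff _ (AlgebraicClosure (ZMod p))).1 ?_
  exact ax_finite V R _ (frob_fixes p)

open MvPolynomial in
theorem ax_graph {K ι : Type} [Field K] [IsAlgClosed K] [CharZero K] [Finite ι]
    (I : Ideal (MvPolynomial ι K)) (J : Ideal (MvPolynomial (ι ⊕ ι) K))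
    (h1 : ∀ x ∈ zeroLocus K I, ∃ y ∈ zeroLocus K I, Sum.elim x y ∈ zeroLocus K J)
    (h2 : ∀ x y z, Sum.elim x y ∈ zeroLocus K J → Sum.elim x z ∈ zeroLocus K J → y = z)
    (h3 : ∀ x y z, Sum.elim x z ∈ zeroLocus K J → Sum.elim y z ∈ zeroLocus K J → x = y) :
    ∀ y ∈ zeroLocus K I, ∃ x ∈ zeroLocus K I, Sum.elim x y ∈ zeroLocus K J := by
  let := compatibleRingOfRing K
  obtain ⟨s, rfl⟩ : I.FG := IsNoetherian.noetherian I
  obtain ⟨t, rfl⟩ : J.FG := IsNoetherian.noetherian J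
  have hs := mvPolynomial_zeroLocus_definable s
  have ht := mvPolynomial_zeroLocus_definable t
  obtain ⟨c, _, hc⟩ := Set.definable_iff_finitely_definable.1 hs
  obtain ⟨d, _, hd⟩ := Set.definable_iff_finitely_definable.1 ht
  classical
  have hc' := hc.mono (Finset.coe_subset.2 (Finset.subset_union_left (s₁ := c) (s₂ := d)))
  have hd' := hd.mono (Finset.coe_subset.2 (Finset.subset_union_right (s₁ := c) (s₂ := d)))
  obtain ⟨V, hV⟩ := Set.definable_iff_exists_formula_sum.1 hc'
  obtain ⟨R, hR⟩ := Set.definable_iff_exists_formula_sum.1 hd'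
  rw [hV, hR] at h1
  rw [hR] at h2 h3
  rw [hV, hR]
  have := ax_ACF V R
  rw [← (ACF_isComplete (Or.inr rfl)).realize_sentence_iff _ K, realize_axSentence] at this
  exact this _ h1 h2 h3

end QFEnd

namespace QFEnd
open AlgebraicGeometry CategoryTheory CategoryTheory.Limits

lemma exists_affine_bij_aux (X : Scheme.{0}) (S : X.Opens) (hS : IsCompact (S : Set X)) :
    ∃ (Z : Scheme.{0}) (ψ : Z ⟶ X), IsAffine Z ∧ LocallyOfFiniteType ψ ∧
      Function.Injective ψ ∧ Set.range ψ = S := by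
  refine compact_open_induction_on
    (P := fun S => ∃ (Z : Scheme.{0}) (ψ : Z ⟶ X), IsAffine Z ∧ LocallyOfFiniteType ψ ∧
      Function.Injective ψ ∧ Set.range ψ = (S : Set X)) S hS ?_ ?_
  · refine ⟨(⊥ : X.Opens), (⊥ : X.Opens).ι, isAffineOpen_bot X, inferInstance, ?_, ?_⟩
    · exact (Scheme.Opens.ι _).isOpenEmbedding.injective
    · simp
  · rintro S - U ⟨Z, ψ, hZ, hψ, hinj, hrange⟩
    have hU : IsAffine U.1 := U.2
    let C : TopologicalSpace.Closeds U.1.toScheme :=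
      ⟨U.1.ι ⁻¹' (S : Set X)ᶜ, S.isOpen.isClosed_compl.preimage U.1.ι.continuous⟩
    let I := Scheme.IdealSheafData.vanishingIdeal C
    let χ : I.subscheme ⟶ X := I.subschemeι ≫ U.1.ι
    have hχ : IsAffine I.subscheme := isAffine_of_isAffineHom I.subschemeι
    have hχr : Set.range χ = (U.1 : Set X) \ S := by
      have : Set.range χ = U.1.ι '' (Set.range I.subschemeι) := by
        rw [← Set.range_comp]; rfl
      rw [this, Scheme.IdealSheafData.range_subschemeι]
      rw [show (I.support : Set U.1.toScheme) = C from Scheme.IdealSheafData.coe_support_vanishingIdeal ..]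
      ext x
      simp only [Set.mem_image]
      constructor
      · rintro ⟨y, hy, rfl⟩
        exact ⟨y.2, hy⟩
      · rintro ⟨h1, h2⟩
        exact ⟨⟨x, h1⟩, h2, rfl⟩
    have hχi : Function.Injective χ := by
      have : ⇑χ = ⇑U.1.ι ∘ ⇑I.subschemeι := rfl
      rw [this]
      exact U.1.ι.isOpenEmbedding.injective.comp I.subschemeι.isClosedEmbedding.injective
    have hl (x) : coprod.desc ψ χ ((coprod.inl : Z ⟶ Z ⨿ I.subscheme) x) = ψ x := by
      rw [← Scheme.Hom.comp_apply, coprod.inl_desc]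
    have hr (x) : coprod.desc ψ χ ((coprod.inr : I.subscheme ⟶ Z ⨿ I.subscheme) x) = χ x := by
      rw [← Scheme.Hom.comp_apply, coprod.inr_desc]
    have hl' (x) : ψ x ∈ S := by
      have : ψ x ∈ Set.range ψ := ⟨x, rfl⟩
      rwa [hrange] at this
    have hr' (x) : χ x ∈ (U.1 : Set X) \ S := by
      have : χ x ∈ Set.range χ := ⟨x, rfl⟩
      rwa [hχr] at this
    refine ⟨Z ⨿ I.subscheme, coprod.desc ψ χ, inferInstance, ?_, ?_, ?_⟩
    · have : IsZariskiLocalAtSource @LocallyOfFiniteType.{0} :=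
        HasRingHomProperty.instIsZariskiLocalAtSource (P := @LocallyOfFiniteType.{0}) (Q := RingHom.FiniteType)
      rw [IsZariskiLocalAtSource.iff_of_openCover (P := @LocallyOfFiniteType)
        (coprodOpenCover.{0, 0} Z I.subscheme)]
      rintro (i | i)
      · change LocallyOfFiniteType (coprod.inl ≫ coprod.desc ψ χ)
        rw [coprod.inl_desc]; infer_instance
      · change LocallyOfFiniteType (coprod.inr ≫ coprod.desc ψ χ)
        rw [coprod.inr_desc]; infer_instance
    · intro x y hxy
      obtain ⟨x, rfl⟩ := (coprodMk Z I.subscheme).surjective x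
      obtain ⟨y, rfl⟩ := (coprodMk Z I.subscheme).surjective y
      rcases x with x | x <;> rcases y with y | y <;>
        simp only [coprodMk_inl, coprodMk_inr, hl, hr] at hxy ⊢
      · rw [hinj hxy]
      · exact absurd (hxy ▸ hl' x) (hr' y).2
      · exact absurd (hxy ▸ hl' y) (hr' x).2
      · rw [hχi hxy]
    · ext z
      constructor
      · rintro ⟨x, rfl⟩
        obtain ⟨x, rfl⟩ := (coprodMk Z I.subscheme).surjective x
        rcases x with x | x <;>
        simp only [coprodMk_inl, coprodMk_inr, hl, hr]
        · exact Or.inl (hl' x)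
        · exact Or.inr (hr' x).1
      · intro hz
        by_cases hzS : z ∈ S
        · have : z ∈ Set.range ψ := by rw [hrange]; exact hzS
          obtain ⟨x, rfl⟩ := this
          exact ⟨_, hl x⟩
        · have : z ∈ Set.range χ := by rw [hχr]; exact ⟨hz.resolve_left hzS, hzS⟩
          obtain ⟨x, rfl⟩ := this
          exact ⟨_, hr x⟩

lemma exists_affine_bij (X : Scheme.{0}) [CompactSpace X] :
    ∃ (Z : Scheme.{0}) (ψ : Z ⟶ X), IsAffine Z ∧ LocallyOfFiniteType ψ ∧
      Function.Bijective ψ := by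
  obtain ⟨Z, ψ, h1, h2, h3, h4⟩ := exists_affine_bij_aux X ⊤ isCompact_univ
  exact ⟨Z, ψ, h1, h2, h3, Set.range_eq_univ.1 h4⟩
end QFEnd

namespace QFEnd
open MvPolynomial TensorProduct

lemma ax_alg {k A C : Type} [Field k] [IsAlgClosed k] [CharZero k] [CommRing A] [Algebra k A]
    [CommRing C] [Algebra k C] [Algebra.FiniteType k A] (p q : A →ₐ[k] C)
    (hpq : Function.Surjective (Algebra.TensorProduct.productMap p q))
    (h1 : ∀ a : A →ₐ[k] k, ∃ c : C →ₐ[k] k, c.comp p = a)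
    (h2 : ∀ c c' : C →ₐ[k] k, c.comp p = c'.comp p → c.comp q = c'.comp q)
    (h3 : ∀ c c' : C →ₐ[k] k, c.comp q = c'.comp q → c.comp p = c'.comp p) :
    ∀ b : A →ₐ[k] k, ∃ c : C →ₐ[k] k, c.comp q = b := by
  obtain ⟨n, π, hπ⟩ := Algebra.FiniteType.iff_quotient_mvPolynomial''.1 (inferInstance : Algebra.FiniteType k A)
  let ρ : MvPolynomial (Fin n ⊕ Fin n) k →ₐ[k] C :=
    aeval (Sum.elim (fun i => p (π (X i))) (fun i => q (π (X i))))
  have hρp : ρ.comp (rename Sum.inl) = p.comp π := by ext i; simp [ρ]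
  have hρq : ρ.comp (rename Sum.inr) = q.comp π := by ext i; simp [ρ]
  have hρ : Function.Surjective ρ := by
    rw [← AlgHom.range_eq_top, eq_top_iff]
    rw [← AlgHom.range_eq_top] at hpq
    rw [← hpq]
    rintro _ ⟨t, rfl⟩
    induction t with
    | zero => simp
    | add x y hx hy => rw [map_add]; exact add_mem hx hy
    | tmul x y =>
      change p x * q y ∈ _
      obtain ⟨x, rfl⟩ := hπ x
      obtain ⟨y, rfl⟩ := hπ y
      refine mul_mem ⟨rename Sum.inl x, ?_⟩ ⟨rename Sum.inr y, ?_⟩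
      · exact DFunLike.congr_fun hρp x
      · exact DFunLike.congr_fun hρq y
  -- points
  have pt : ∀ {σ B : Type} [CommRing B] [Algebra k B] (r : MvPolynomial σ k →ₐ[k] B)
      (hr : Function.Surjective r) (x : σ → k), x ∈ zeroLocus k (RingHom.ker r) →
      ∃ a : B →ₐ[k] k, ∀ i, a (r (X i)) = x i := by
    intro σ B _ _ r hr x hx
    have hle : RingHom.ker r.toRingHom ≤ RingHom.ker
        (aeval x : MvPolynomial σ k →ₐ[k] k).toRingHom := by
      intro t ht
      exact (mem_zeroLocus_iff.1 hx) t ht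
    exact ⟨AlgHom.liftOfSurjective r hr (aeval x) hle, fun i =>
      (AlgHom.liftOfSurjective_apply r hr (aeval x) hle (X i)).trans (aeval_X _ _)⟩
  have pt' : ∀ {σ B : Type} [CommRing B] [Algebra k B] (r : MvPolynomial σ k →ₐ[k] B)
      (a : B →ₐ[k] k), (fun i => a (r (X i))) ∈ zeroLocus k (RingHom.ker r) := by
    intro σ B _ _ r a t ht
    have : (aeval (fun i => a (r (X i))) : MvPolynomial σ k →ₐ[k] k) = a.comp r := by
      ext i; simp
    rw [this]
    simp [(RingHom.mem_ker).1 ht]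
  have ext' : ∀ a b : A →ₐ[k] k, (∀ i, a (π (X i)) = b (π (X i))) → a = b := by
    intro a b h
    have : a.comp π = b.comp π := by ext i; simp [h]
    ext t
    obtain ⟨t, rfl⟩ := hπ t
    exact DFunLike.congr_fun this t
  have key := ax_graph (RingHom.ker π) (RingHom.ker ρ) ?_ ?_ ?_
  · intro b
    obtain ⟨x, hx, hxy⟩ := key _ (pt' π b)
    obtain ⟨c, hc⟩ := pt ρ hρ _ hxy
    refine ⟨c, ext' _ _ fun i => ?_⟩
    simpa [ρ] using hc (Sum.inr i)
  · intro x hx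
    obtain ⟨a, ha⟩ := pt π hπ x hx
    obtain ⟨c, hc⟩ := h1 a
    refine ⟨_, pt' π (c.comp q), ?_⟩
    have := pt' ρ c
    convert this using 1
    ext i
    rcases i with i | i
    · simp [ρ, ← ha, ← hc]
    · simp [ρ]
  · intro x y z hy hz
    obtain ⟨c, hc⟩ := pt ρ hρ _ hy
    obtain ⟨d, hd⟩ := pt ρ hρ _ hz
    have := h2 c d (ext' _ _ fun i => by
      have h1 := hc (Sum.inl i)
      have h2 := hd (Sum.inl i)
      simp [ρ] at h1 h2
      simp [h1, h2])
    ext i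
    have h1 := hc (Sum.inr i)
    have h2 := hd (Sum.inr i)
    simp [ρ] at h1 h2
    rw [← h1, ← h2]
    exact DFunLike.congr_fun this _
  · intro x y z hy hz
    obtain ⟨c, hc⟩ := pt ρ hρ _ hy
    obtain ⟨d, hd⟩ := pt ρ hρ _ hz
    have := h3 c d (ext' _ _ fun i => by
      have h1 := hc (Sum.inr i)
      have h2 := hd (Sum.inr i)
      simp [ρ] at h1 h2
      simp [h1, h2])
    ext i
    have h1 := hc (Sum.inl i)
    have h2 := hd (Sum.inl i)
    simp [ρ] at h1 h2
    rw [← h1, ← h2]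
    exact DFunLike.congr_fun this _
end QFEnd

namespace QFEnd
open AlgebraicGeometry CategoryTheory CategoryTheory.Limits

lemma mapDesc_congr_fst {C : Type*} [Category C] [HasPullbacks C] {X Y S T : C} (u : X ⟶ S)
    (v : Y ⟶ S) (i : S ⟶ T) {u' : X ⟶ T} {v' : Y ⟶ T} (e1 : u ≫ i = u') (e2 : v ≫ i = v') :
    pullback.mapDesc u v i ≫ (pullback.congrHom e1 e2).hom ≫ pullback.fst u' v' =
      pullback.fst u v := by
  subst e1 e2
  simp only [pullback.congrHom_hom, pullback.mapDesc, pullback.map, Category.comp_id]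
  rw [pullback.lift_fst, pullback.lift_fst]

lemma mapDesc_congr_snd {C : Type*} [Category C] [HasPullbacks C] {X Y S T : C} (u : X ⟶ S)
    (v : Y ⟶ S) (i : S ⟶ T) {u' : X ⟶ T} {v' : Y ⟶ T} (e1 : u ≫ i = u') (e2 : v ≫ i = v') :
    pullback.mapDesc u v i ≫ (pullback.congrHom e1 e2).hom ≫ pullback.snd u' v' =
      pullback.snd u v := by
  subst e1 e2
  simp only [pullback.congrHom_hom, pullback.mapDesc, pullback.map, Category.comp_id]
  rw [pullback.lift_snd, pullback.lift_snd]

lemma pt_lift {k : Type} [Field k] [IsAlgClosed k] {Z X : Scheme.{0}}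
    (f : X ⟶ Spec (.of k)) [LocallyOfFiniteType f] (ψ : Z ⟶ X) [LocallyOfFiniteType ψ]
    (hψ : Function.Bijective ψ) (b : Spec (.of k) ⟶ X) (hb : b ≫ f = 𝟙 _) :
    ∃ a : Spec (.of k) ⟶ Z, a ≫ ψ = b := by
  let x := b (IsLocalRing.closedPoint k)
  have hx : IsClosed {x} := (pointEquivClosedPoint f ⟨b, hb⟩).2
  obtain ⟨z, hz⟩ := hψ.2 x
  have hzc : IsClosed {z} := by
    have : {z} = ψ ⁻¹' {x} := by
      ext w
      simp only [Set.mem_singleton_iff, Set.mem_preimage]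
      rw [← hz]
      exact hψ.1.eq_iff.symm
    rw [this]
    exact hx.preimage ψ.continuous
  refine ⟨pointOfClosedPoint (ψ ≫ f) z hzc, ?_⟩
  refine ext_of_apply_closedPoint_eq f (by simp) hb ?_
  exact (congrArg ψ (pointOfClosedPoint_apply (ψ ≫ f) z hzc _)).trans hz

lemma ax_scheme {k : Type} [Field k] [IsAlgClosed k] [CharZero k] {X : Scheme.{0}}
    (f : X ⟶ Spec (.of k)) [LocallyOfFiniteType f] [QuasiCompact f] [IsSeparated f]
    (φ : X ⟶ X) (hφ : φ ≫ f = f) (hinj : Function.Injective φ) (x : X) (hx : IsClosed {x}) :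
    x ∈ Set.range φ := by
  have : CompactSpace X := by
    have := (quasiCompact_iff_compactSpace (f := f)).1 inferInstance
    exact this
  obtain ⟨Z, ψ₀, hZ, hψ₀, hbij₀⟩ := exists_affine_bij X
  obtain ⟨A, hA, ⟨e⟩⟩ : ∃ (A : Type) (_ : CommRing A), Nonempty (Spec (.of A) ≅ Z) :=
    ⟨Γ(Z, ⊤), inferInstance, ⟨Z.isoSpec.symm⟩⟩
  let ψ : Spec (.of A) ⟶ X := e.hom ≫ ψ₀
  have hψ : LocallyOfFiniteType ψ := inferInstanceAs (LocallyOfFiniteType (e.hom ≫ ψ₀))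
  have hbij : Function.Bijective ψ := by
    have : ⇑ψ = ⇑ψ₀ ∘ ⇑e.hom := rfl
    rw [this]
    exact hbij₀.comp e.hom.homeomorph.bijective
  clear_value ψ
  clear hbij₀ hψ₀ ψ₀ e hZ Z
  -- algebra structure
  obtain ⟨a₀, ha₀⟩ : ∃ a₀ : CommRingCat.of k ⟶ CommRingCat.of A, Spec.map a₀ = ψ ≫ f :=
    ⟨Spec.preimage _, Spec.map_preimage _⟩
  let _ : Algebra k A := a₀.hom.toAlgebra
  have hft : Algebra.FiniteType k A := by
    have : LocallyOfFiniteType (Spec.map a₀) := by rw [ha₀]; infer_instance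
    exact (HasRingHomProperty.Spec_iff (P := @LocallyOfFiniteType)).1 this
  have hcl : IsClosedImmersion (pullback.mapDesc (ψ ≫ φ) ψ f) := inferInstance
  have e1 : (ψ ≫ φ) ≫ f = Spec.map (CommRingCat.ofHom (algebraMap k A)) := by
    rw [Category.assoc, hφ]; exact ha₀.symm
  have e2 : ψ ≫ f = Spec.map (CommRingCat.ofHom (algebraMap k A)) := ha₀.symm
  let m : pullback (ψ ≫ φ) ψ ⟶ Spec (.of (TensorProduct k A A)) :=
    pullback.mapDesc (ψ ≫ φ) ψ f ≫ (pullback.congrHom e1 e2).hom ≫ (pullbackSpecIso k A A).hom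
  have hm : IsClosedImmersion m := inferInstanceAs (IsClosedImmersion (_ ≫ _ ≫ _))
  obtain ⟨I, j, hj⟩ := IsClosedImmersion.Spec_iff.1 hm
  let C := TensorProduct k A A ⧸ I
  let c : TensorProduct k A A →ₐ[k] C := Ideal.Quotient.mkₐ k I
  let p : A →ₐ[k] C := c.comp Algebra.TensorProduct.includeLeft
  let q : A →ₐ[k] C := c.comp Algebra.TensorProduct.includeRight
  have hP : j.hom ≫ Spec.map (CommRingCat.ofHom p.toRingHom) = pullback.fst _ _ := by
    have : CommRingCat.ofHom p.toRingHom =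
      CommRingCat.ofHom Algebra.TensorProduct.includeLeftRingHom ≫ CommRingCat.ofHom c.toRingHom := rfl
    rw [this, Spec.map_comp]
    have h2 : m = j.hom ≫ Spec.map (CommRingCat.ofHom c.toRingHom) := hj
    rw [← Category.assoc, ← h2]
    simp only [m, Category.assoc]
    rw [pullbackSpecIso_hom_fst]
    exact mapDesc_congr_fst _ _ _ _ _
  have hQ : j.hom ≫ Spec.map (CommRingCat.ofHom q.toRingHom) = pullback.snd _ _ := by
    have : CommRingCat.ofHom q.toRingHom =
      CommRingCat.ofHom Algebra.TensorProduct.includeRight.toRingHom ≫ CommRingCat.ofHom c.toRingHom := rfl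
    rw [this, Spec.map_comp]
    have h2 : m = j.hom ≫ Spec.map (CommRingCat.ofHom c.toRingHom) := hj
    rw [← Category.assoc, ← h2]
    simp only [m, Category.assoc]
    refine (congrArg (fun t => pullback.mapDesc (ψ ≫ φ) ψ f ≫ (pullback.congrHom e1 e2).hom ≫ t)
      (pullbackSpecIso_hom_snd k A A)).trans ?_
    exact mapDesc_congr_snd _ _ _ _ _
  have hpq : Function.Surjective (Algebra.TensorProduct.productMap p q) := by
    have : Algebra.TensorProduct.productMap p q = c := by
      ext
      · simp [p]
      · simp [q]
    rw [this]
    exact Ideal.Quotient.mkₐ_surjective k I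
  -- points
  have toAlg : ∀ {B : Type} [CommRing B] [Algebra k B] (a : Spec (.of k) ⟶ Spec (.of B)),
      a ≫ Spec.map (CommRingCat.ofHom (algebraMap k B)) = 𝟙 _ →
      ∃ α : B →ₐ[k] k, Spec.map (CommRingCat.ofHom α.toRingHom) = a := by
    intro B _ _ a ha
    obtain ⟨a, rfl⟩ : ∃ b, Spec.map b = a := ⟨_, Spec.map_preimage _⟩
    rw [← Spec.map_comp, ← Spec.map_id, Spec.map_inj] at ha
    refine ⟨⟨a.hom, fun r => ?_⟩, rfl⟩
    exact congr($(ha) r)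
  have ofAlg : ∀ {B : Type} [CommRing B] [Algebra k B] (α : B →ₐ[k] k),
      Spec.map (CommRingCat.ofHom α.toRingHom) ≫ Spec.map (CommRingCat.ofHom (algebraMap k B))
        = 𝟙 _ := by
    intro B _ _ α
    rw [← Spec.map_comp, ← Spec.map_id]
    congr 1
    ext r
    exact α.commutes r
  have compAlg : ∀ {B D : Type} [CommRing B] [Algebra k B] [CommRing D] [Algebra k D]
      (α : D →ₐ[k] k) (β : B →ₐ[k] D), Spec.map (CommRingCat.ofHom (α.comp β).toRingHom) =
      Spec.map (CommRingCat.ofHom α.toRingHom) ≫ Spec.map (CommRingCat.ofHom β.toRingHom) := by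
    intro B D _ _ _ _ α β
    rw [← Spec.map_comp]
    rfl
  have injAlg : ∀ {B : Type} [CommRing B] [Algebra k B] (α β : B →ₐ[k] k),
      Spec.map (CommRingCat.ofHom α.toRingHom) = Spec.map (CommRingCat.ofHom β.toRingHom) →
      α = β := by
    intro B _ _ α β h
    rw [Spec.map_inj] at h
    ext r
    exact congr($(h) r)
  have pb : ∀ γ : C →ₐ[k] k, Spec.map (CommRingCat.ofHom (γ.comp p).toRingHom) ≫ ψ ≫ φ =
      Spec.map (CommRingCat.ofHom (γ.comp q).toRingHom) ≫ ψ := by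
    intro γ
    rw [compAlg, compAlg, (Iso.eq_inv_comp j).2 hP, (Iso.eq_inv_comp j).2 hQ]
    simp only [Category.assoc]
    rw [pullback.condition]
  have hψf : ∀ (α : A →ₐ[k] k), (Spec.map (CommRingCat.ofHom α.toRingHom) ≫ ψ) ≫ f = 𝟙 _ := by
    intro α
    rw [Category.assoc, e2]
    exact ofAlg α
  have hext : ∀ (α β : A →ₐ[k] k), (Spec.map (CommRingCat.ofHom α.toRingHom) ≫ ψ)
        (IsLocalRing.closedPoint k) = (Spec.map (CommRingCat.ofHom β.toRingHom) ≫ ψ)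
        (IsLocalRing.closedPoint k) → α = β := by
    intro α β h
    apply injAlg
    refine ext_of_apply_closedPoint_eq (ψ ≫ f) ?_ ?_ ?_
    · rw [← Category.assoc]; exact hψf α
    · rw [← Category.assoc]; exact hψf β
    · exact hbij.1 h
  have key := ax_alg p q hpq ?_ ?_ ?_
  · obtain ⟨b, hb⟩ := pt_lift f ψ hbij (pointOfClosedPoint f x hx) (by simp)
    obtain ⟨β, hβ⟩ := toAlg b (by rw [← e2, ← Category.assoc, hb]; simp)
    obtain ⟨γ, hγ⟩ := key β
    have := pb γ
    rw [hγ, hβ, hb] at this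
    have h3 := congr($(this) (IsLocalRing.closedPoint k))
    exact ⟨_, h3.trans (pointOfClosedPoint_apply f x hx _)⟩
  · intro α
    obtain ⟨b, hb⟩ := pt_lift f ψ hbij (Spec.map (CommRingCat.ofHom α.toRingHom) ≫ ψ ≫ φ) (by
      rw [Category.assoc, e1]; exact ofAlg α)
    let g : Spec (.of k) ⟶ pullback (ψ ≫ φ) ψ := pullback.lift _ b hb.symm
    obtain ⟨γ, hγ⟩ := toAlg (g ≫ j.hom) (by
      have : CommRingCat.ofHom (algebraMap k C) = CommRingCat.ofHom (algebraMap k A) ≫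
        CommRingCat.ofHom p.toRingHom := by
          ext r; exact (p.commutes r).symm
      have h4 : Spec.map (CommRingCat.ofHom (algebraMap k C)) =
        Spec.map (CommRingCat.ofHom p.toRingHom) ≫ Spec.map (CommRingCat.ofHom (algebraMap k A)) := by
          rw [← Spec.map_comp]; exact congrArg Spec.map this
      have h5 : g ≫ pullback.fst _ _ ≫ Spec.map (CommRingCat.ofHom (algebraMap k A)) = 𝟙 _ := by
        rw [← Category.assoc, pullback.lift_fst]
        exact ofAlg α
      refine Eq.trans ?_ h5
      rw [Category.assoc]
      congr 1
      rw [← hP, Category.assoc]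
      exact congrArg _ h4)
    refine ⟨γ, injAlg _ _ ?_⟩
    rw [compAlg, hγ, Category.assoc]
    have : j.hom ≫ Spec.map (CommRingCat.ofHom p.toRingHom) = pullback.fst _ _ := hP
    refine (congrArg (fun t => g ≫ t) this).trans ?_
    exact pullback.lift_fst ..
  · intro γ δ h
    apply hext
    rw [← pb γ, ← pb δ, h]
  · intro γ δ h
    apply hext
    apply hinj
    have h6 := (pb γ).trans ((congrArg (fun t : A →ₐ[k] k => Spec.map (CommRingCat.ofHom t.toRingHom) ≫ ψ) h).trans (pb δ).symm)
    exact congr($(h6) (IsLocalRing.closedPoint k))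

lemma isIso_of_isOpenImmersion {k : Type} [Field k] [IsAlgClosed k] [CharZero k] {X : Scheme.{0}}
    (f : X ⟶ Spec (.of k)) [LocallyOfFiniteType f] [QuasiCompact f] [IsSeparated f]
    (φ : X ⟶ X) (hφ : φ ≫ f = f) [IsOpenImmersion φ] : IsIso φ := by
  rw [isIso_iff_isOpenImmersion_and_surjective]
  refine ⟨inferInstance, ⟨?_⟩⟩
  have : JacobsonSpace X := LocallyOfFiniteType.jacobsonSpace f
  rw [← Set.range_eq_univ]
  by_contra hne
  have hc : IsClosed (Set.range φ)ᶜ := φ.isOpenEmbedding.isOpen_range.isClosed_compl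
  obtain ⟨x, hx, hx'⟩ := nonempty_inter_closedPoints (Z := (Set.range φ)ᶜ)
    (by rwa [Set.nonempty_compl]) hc.isLocallyClosed
  exact hx (ax_scheme f φ hφ φ.isOpenEmbedding.injective x hx')
end QFEnd

namespace QFEnd
open AlgebraicGeometry CategoryTheory CategoryTheory.Limits

lemma krull_bound (k R : Type) [Field k] [CommRing R] [Algebra k R] [Algebra.FiniteType k R] :
    ∃ N : ℕ, ∀ p : LTSeries (PrimeSpectrum R), p.length ≤ N := by
  obtain ⟨n, π, hπ⟩ := Algebra.FiniteType.iff_quotient_mvPolynomial''.1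
    (inferInstance : Algebra.FiniteType k R)
  refine ⟨n, fun p => ?_⟩
  have h1 : ringKrullDim R ≤ n := by
    refine (ringKrullDim_le_of_surjective π.toRingHom hπ).trans ?_
    rw [MvPolynomial.ringKrullDim_of_isNoetherianRing]
    simp
  have h2 := (Order.LTSeries.length_le_krullDim p).trans h1
  exact_mod_cast h2

lemma generic_fixed (k : Type) [Field k] (X : Scheme.{0}) [IsIntegral X]
    (f : X ⟶ Spec (CommRingCat.of k)) [LocallyOfFiniteType f] [QuasiCompact f]
    (φ : X ⟶ X) [LocallyQuasiFinite φ] : φ (genericPoint X) = genericPoint X := by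
  have : CompactSpace X := (quasiCompact_iff_compactSpace (f := f)).1 inferInstance
  let _ : Preorder X := specializationPreorder X
  have hle : ∀ x y : X, x ≤ y ↔ y ⤳ x := fun x y => Iff.rfl
  have hlt : ∀ x y : X, x < y ↔ y ⤳ x ∧ x ≠ y := by
    intro x y
    rw [lt_iff_le_not_ge, hle, hle]
    refine and_congr_right fun h => ?_
    constructor
    · rintro h' rfl; exact h' h
    · intro h' h''; exact h' (h''.antisymm h).eq
  -- bound
  have hb1 : ∀ x : X, ∃ V ∈ nhds x, ∃ N : ℕ, ∀ p : LTSeries X, p.head ∈ V → p.length ≤ N := by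
    intro x
    obtain ⟨R, g, hg, hx⟩ : ∃ (R : CommRingCat.{0}) (g : Spec R ⟶ X), IsOpenImmersion g ∧
        x ∈ Set.range g :=
      ⟨_, X.affineCover.f (X.affineCover.idx x), X.affineCover.map_prop _, X.affineCover.covers x⟩
    refine ⟨Set.range g, g.isOpenEmbedding.isOpen_range.mem_nhds hx, ?_⟩
    obtain ⟨a₀, ha₀⟩ : ∃ a₀ : CommRingCat.of k ⟶ R, Spec.map a₀ = g ≫ f :=
      ⟨Spec.preimage _, Spec.map_preimage _⟩
    let _ : Algebra k R := a₀.hom.toAlgebra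
    have hft : Algebra.FiniteType k R := by
      have : LocallyOfFiniteType (Spec.map a₀) := by rw [ha₀]; infer_instance
      exact (HasRingHomProperty.Spec_iff (P := @LocallyOfFiniteType)).1 this
    obtain ⟨N, hN⟩ := krull_bound k R
    refine ⟨N, fun p hp => ?_⟩
    have hmem : ∀ j, p j ∈ Set.range g := by
      intro j
      have : p.head ≤ p j := p.strictMono.monotone (Fin.zero_le j)
      exact Specializes.mem_open ((hle _ _).1 this) g.isOpenEmbedding.isOpen_range hp
    choose q hq using hmem
    let q' : Fin (p.length + 1) → PrimeSpectrum R := fun j => q j.rev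
    have hq' : StrictMono q' := by
      intro i j hij
      have h1 : p j.rev < p i.rev := p.strictMono (Fin.rev_lt_rev.2 hij)
      rw [hlt] at h1
      rw [← hq, ← hq, g.isOpenEmbedding.isInducing.specializes_iff] at h1
      refine lt_of_le_of_ne ((PrimeSpectrum.le_iff_specializes _ _).2 h1.1) ?_
      intro h2
      exact h1.2 (congrArg g h2).symm
    exact hN ⟨p.length, q', fun i => hq' Fin.castSucc_lt_succ⟩
  have hb : ∃ N : ℕ, ∀ p : LTSeries X, p.length ≤ N := by
    choose V hV N hN using hb1
    obtain ⟨t, ht⟩ := CompactSpace.elim_nhds_subcover V hV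
    refine ⟨t.sup N, fun p => ?_⟩
    have : p.head ∈ ⋃ x ∈ t, V x := by rw [ht]; trivial
    simp only [Set.mem_iUnion] at this
    obtain ⟨x, hx, hpx⟩ := this
    exact (hN x p hpx).trans (Finset.le_sup (f := N) hx)
  have hmax : ∃ p : LTSeries X, ∀ q : LTSeries X, q.length ≤ p.length := by
    obtain ⟨N, hN⟩ := hb
    have hfin : (Set.range (fun p : LTSeries X => p.length)).Finite :=
      (Set.finite_Iic N).subset (by rintro _ ⟨p, rfl⟩; exact hN p)
    obtain ⟨m, ⟨p, hp⟩, hm⟩ := Set.exists_max_image _ id hfin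
      ⟨_, RelSeries.singleton _ (genericPoint X), rfl⟩
    refine ⟨p, fun q => ?_⟩
    have := hm _ ⟨q, rfl⟩
    simp only [id] at this
    exact this.trans hp.ge
  have hmono : StrictMono φ := by
    intro x y hxy
    rw [hlt] at hxy ⊢
    refine ⟨hxy.1.map φ.continuous, fun h => hxy.2 ?_⟩
    have hd := φ.isDiscrete_preimage_singleton (φ y)
    have := hd.to_subtype
    have h1 : (⟨y, rfl⟩ : (φ ⁻¹' {φ y} : Set X)) ⤳ ⟨x, h⟩ := by
      rw [Topology.IsInducing.subtypeVal.specializes_iff.symm]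
      exact hxy.1
    exact congrArg Subtype.val h1.eq.symm
  obtain ⟨p, hp⟩ := hmax
  have hgen : ∀ q : LTSeries X, q.length = p.length → q.last = genericPoint X := by
    intro q hq
    by_contra hne
    have h1 : q.last < genericPoint X := by
      rw [hlt]
      exact ⟨genericPoint_specializes _, hne⟩
    have := hp (q.snoc (genericPoint X) h1)
    simp at this
    omega
  have h1 := hgen p rfl
  have h2 := hgen (p.map φ hmono) rfl
  rw [LTSeries.last_map, h1] at h2
  exact h2
end QFEnd

namespace QFEnd
open AlgebraicGeometry CategoryTheory CategoryTheory.Limits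

lemma univInj_of_inj {k : Type} [Field k] [IsAlgClosed k] {X Y : Scheme.{0}}
    (f : X ⟶ Spec (.of k)) [LocallyOfFiniteType f] (h : Y ⟶ Spec (.of k)) 
    (g : X ⟶ Y) (hg : g ≫ h = f) [IsSeparated g] (hinj : Function.Injective g) :
    UniversallyInjective g := by
  have : LocallyOfFiniteType g := by
    have : LocallyOfFiniteType (g ≫ h) := by rw [hg]; infer_instance
    exact locallyOfFiniteType_of_comp g h
  rw [UniversallyInjective.iff_diagonal]
  let s : pullback g g ⟶ Spec (.of k) := pullback.fst g g ≫ f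
  have hs : LocallyOfFiniteType s := inferInstanceAs (LocallyOfFiniteType (_ ≫ _))
  have hJ : JacobsonSpace ↥(pullback g g) := LocallyOfFiniteType.jacobsonSpace s
  refine ⟨?_⟩
  rw [← Set.range_eq_univ]
  by_contra hne
  have hc : IsClosed (Set.range (pullback.diagonal g))ᶜᶜ := by
    rw [compl_compl]
    exact (pullback.diagonal g).isClosedEmbedding.isClosed_range
  obtain ⟨w, hw, hw'⟩ := nonempty_inter_closedPoints (Z := (Set.range (pullback.diagonal g))ᶜ)
    (by rwa [Set.nonempty_compl]) (isClosed_compl_iff.1 hc).isLocallyClosed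
  apply hw
  let p := pointOfClosedPoint s w hw'
  have hp : p ≫ s = 𝟙 _ := pointOfClosedPoint_comp s w hw'
  have hs2 : pullback.snd g g ≫ f = s := by
    simp only [s, ← hg]
    rw [← Category.assoc, ← pullback.condition, Category.assoc]
  have h1 : p ≫ pullback.fst g g = p ≫ pullback.snd g g := by
    refine ext_of_apply_closedPoint_eq f (by rw [Category.assoc]; exact hp)
      (by rw [Category.assoc, hs2]; exact hp) ?_
    apply hinj
    have : (p ≫ pullback.fst g g) ≫ g = (p ≫ pullback.snd g g) ≫ g := by
      rw [Category.assoc, pullback.condition, Category.assoc]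
    exact congr($(this) (IsLocalRing.closedPoint k))
  have h2 : p = (p ≫ pullback.fst g g) ≫ pullback.diagonal g := by
    apply pullback.hom_ext
    · simp
    · simp [h1]
  refine ⟨(p ≫ pullback.fst g g) (IsLocalRing.closedPoint k), ?_⟩
  refine Eq.trans ?_ (pointOfClosedPoint_apply s w hw' (IsLocalRing.closedPoint k))
  exact congr($(h2.symm) (IsLocalRing.closedPoint k))

lemma residueFieldMap_bijective {k : Type} [Field k] [IsAlgClosed k] [CharZero k] {X : Scheme.{0}}
    (f : X ⟶ Spec (.of k)) [LocallyOfFiniteType f] [IsSeparated f]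
    (φ : X ⟶ X) (hφ : φ ≫ f = f) (U : X.Opens) (hinj : Set.InjOn φ (U : Set X))
    (x : X) (hx : x ∈ U) : IsIso (φ.residueFieldMap x) := by
  have hsep : IsSeparated φ := by
    have : IsSeparated (φ ≫ f) := by rw [hφ]; infer_instance
    exact IsSeparated.of_comp φ f
  have hui : UniversallyInjective (U.ι ≫ φ) := by
    refine univInj_of_inj (U.ι ≫ f) f (U.ι ≫ φ) (by rw [Category.assoc, hφ]) ?_
    intro a b hab
    exact Subtype.ext (hinj a.2 b.2 hab)
  let y : U.toScheme := ⟨x, hx⟩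
  have h0 : UniversallyInjective (U.ι ≫ φ) ↔ (Function.Injective (U.ι ≫ φ) ∧
      ∀ x, ((U.ι ≫ φ).residueFieldMap x).hom.IsPurelyInseparable) :=
    (tfae_universallyInjective (U.ι ≫ φ)).out 0 2
  have h1 := (h0.1 hui).2 y
  rw [Scheme.residueFieldMap_comp] at h1
  have hz : CharZero (X.residueField (φ x)) := by
    have r : k →+* X.residueField (φ x) :=
      (Spec.preimage (X.fromSpecResidueField (φ x) ≫ f)).hom
    exact charZero_of_injective_ringHom r.injective
  have h2 : Function.Bijective (φ.residueFieldMap (U.ι y) ≫ U.ι.residueFieldMap y).hom := by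
    refine ⟨RingHom.injective _, ?_⟩
    let _ : Algebra (X.residueField (φ x)) (U.toScheme.residueField y) :=
      (φ.residueFieldMap (U.ι y) ≫ U.ι.residueFieldMap y).hom.toAlgebra
    have : IsPurelyInseparable (X.residueField (φ x)) (U.toScheme.residueField y) := h1
    exact IsPurelyInseparable.surjective_algebraMap_of_isSeparable
      (X.residueField (φ x)) (U.toScheme.residueField y)
  have h3 : IsIso (φ.residueFieldMap (U.ι y) ≫ U.ι.residueFieldMap y) :=
    (ConcreteCategory.isIso_iff_bijective _).2 h2
  exact IsIso.of_isIso_comp_right (φ.residueFieldMap (U.ι y)) (U.ι.residueFieldMap y)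
end QFEnd

namespace QFEnd
open scoped nonZeroDivisors

lemma intClos_noeth_frac (k A F : Type) [Field k] [CharZero k] [CommRing A] [IsDomain A] [Algebra k A]
    [Algebra.FiniteType k A] [Field F] [Algebra A F] [IsFractionRing A F] :
    Module.Finite A (integralClosure A F) := by
  obtain ⟨s, g, hg, hgf⟩ := exists_finite_inj_algHom_of_fg k A
  let P := MvPolynomial (Fin s) k
  let _ : Algebra P A := g.toRingHom.toAlgebra
  have : Module.Finite P A := hgf
  have hinj : Function.Injective (algebraMap P A) := hg
  have : FaithfulSMul P A := (faithfulSMul_iff_algebraMap_injective P A).2 hinj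
  let _ : Algebra P F := ((algebraMap A F).comp (algebraMap P A)).toAlgebra
  have : IsScalarTower P A F := .of_algebraMap_eq' rfl
  have hinjF : Function.Injective (algebraMap P F) := (IsFractionRing.injective A F).comp hinj
  have : FaithfulSMul P F := (faithfulSMul_iff_algebraMap_injective P F).2 hinjF
  let K := FractionRing P
  let _ : Algebra K F := FractionRing.liftAlgebra P F
  have : IsScalarTower P K F := inferInstance
  have hloc : IsLocalization (Algebra.algebraMapSubmonoid A P⁰) F := inferInstance
  have : FiniteDimensional K F := .of_isLocalization P A P⁰
  have : CharZero K := charZero_of_injective_algebraMap (algebraMap k K).injective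
  let _ : Algebra P (integralClosure A F) := ((algebraMap A (integralClosure A F)).comp (algebraMap P A)).toAlgebra
  have : IsScalarTower P A (integralClosure A F) := .of_algebraMap_eq' rfl
  have : IsScalarTower P (integralClosure A F) F := .of_algebraMap_eq' rfl
  have : Algebra.IsIntegral P A := inferInstance
  have : IsIntegralClosure (integralClosure A F) P F := by
    refine ⟨Subtype.val_injective, fun {x} => ⟨fun h => ⟨⟨x, h.tower_top⟩, rfl⟩, ?_⟩⟩
    rintro ⟨y, rfl⟩
    exact isIntegral_trans _ y.2
  have : Module.Finite P (integralClosure A F) := IsIntegralClosure.finite P K F _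
  exact Module.Finite.of_restrictScalars_finite P A _

lemma intClos_finite {k A L F : Type} [Field k] [CharZero k] [CommRing A] [IsDomain A] [Algebra k A]
    [Algebra.FiniteType k A] [Field F] [Algebra A F] [IsFractionRing A F] [CommRing L] [Algebra A L]
    (j : L →ₐ[A] F) (hj : Function.Injective j) :
    Module.Finite A (integralClosure A L) := by
  have h1 := intClos_noeth_frac k A F
  have : IsNoetherianRing A := Algebra.FiniteType.isNoetherianRing k A
  have : IsNoetherian A (integralClosure A F) := inferInstance
  let r : integralClosure A L →ₐ[A] integralClosure A F :=
    (j.comp (integralClosure A L).val).codRestrict _ (fun x => x.2.map j)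
  have : IsNoetherian A (integralClosure A L) := isNoetherian_of_injective r.toLinearMap
    (fun x y h => Subtype.ext (hj (congrArg Subtype.val h)))
  infer_instance
end QFEnd

namespace QFEnd
open AlgebraicGeometry CategoryTheory CategoryTheory.Limits

lemma normalization_finite {k : Type} [Field k] [CharZero k] {X : Scheme.{0}} [IsIntegral X]
    (f : X ⟶ Spec (.of k)) [LocallyOfFiniteType f] {Z : Scheme.{0}} (g : Z ⟶ X) [QuasiCompact g]
    [QuasiSeparated g] (e : Spec X.functionField ⟶ Z) [IsIso e]
    (he : e ≫ g = X.fromSpecStalk (genericPoint X)) :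
    IsFinite g.fromNormalization := by
  refine ⟨fun U hU => ?_⟩
  rw [g.fromNormalization_app hU]
  let _ : Algebra Γ(X, U) Γ(Z, g ⁻¹ᵁ U) := (g.app U).hom.toAlgebra
  suffices h : Module.Finite Γ(X, U) (integralClosure Γ(X, U) Γ(Z, g ⁻¹ᵁ U)) by
    have h1 : (algebraMap Γ(X, U) (integralClosure Γ(X, U) Γ(Z, g ⁻¹ᵁ U))).Finite :=
      RingHom.finite_algebraMap.2 h
    rw [CommRingCat.hom_comp]
    refine RingHom.Finite.comp ?_ h1
    exact RingHom.Finite.of_surjective _ (ConcreteCategory.bijective_of_isIso (g.normalizationObjIso hU).inv).2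
  rcases isEmpty_or_nonempty U with hE | hN
  · have : U = ⊥ := by
      ext x; simp only [SetLike.mem_coe]; exact ⟨fun hx => (hE.false ⟨x, hx⟩).elim, fun hx => hx.elim⟩
    subst this
    have : Subsingleton Γ(X, ⊥) := inferInstance
    have := Module.subsingleton Γ(X, ⊥) (integralClosure Γ(X, ⊥) Γ(Z, g ⁻¹ᵁ ⊥))
    infer_instance
  have hη : genericPoint X ∈ U := ((genericPoint_spec X).mem_open_set_iff U.isOpen).mpr (by simpa using hN)
  let a : k →+* Γ(X, U) := (f.appLE ⊤ U (by simp)).hom.comp (Scheme.ΓSpecIso (.of k)).inv.hom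
  have ha : a.FiniteType := by
    refine RingHom.FiniteType.comp (f.finiteType_appLE (isAffineOpen_top _) hU _) ?_
    exact RingHom.FiniteType.of_surjective _ (ConcreteCategory.bijective_of_isIso (Scheme.ΓSpecIso (.of k)).inv).2
  let _ : Algebra k Γ(X, U) := a.toAlgebra
  have : Algebra.FiniteType k Γ(X, U) := ha
  have : IsFractionRing Γ(X, U) X.functionField := functionField_isFractionRing_of_isAffineOpen X U hU
  have htop : e ⁻¹ᵁ g ⁻¹ᵁ U = ⊤ := by
    rw [← Scheme.Hom.comp_preimage, he]
    ext x
    simp only [Scheme.Hom.mem_preimage, SetLike.mem_coe, TopologicalSpace.Opens.coe_top, Set.mem_univ, iff_true]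
    have : X.fromSpecStalk (genericPoint X) x ∈ Set.range (X.fromSpecStalk (genericPoint X)) := ⟨x, rfl⟩
    rw [Scheme.range_fromSpecStalk] at this
    exact Specializes.mem_open this U.isOpen hη
  let j₀ : Γ(Z, g ⁻¹ᵁ U) ⟶ X.functionField := 
    e.appLE (g ⁻¹ᵁ U) ⊤ htop.ge ≫ (Scheme.ΓSpecIso X.functionField).hom
  have hj : g.app U ≫ j₀ = X.germToFunctionField U := by
    have hle : ⊤ ≤ X.fromSpecStalk (genericPoint X) ⁻¹ᵁ U := by
      rw [← he, Scheme.Hom.comp_preimage, htop]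
    have h1 : (X.fromSpecStalk (genericPoint X)).appLE U ⊤ hle =
        X.presheaf.germ U (genericPoint X) hη ≫ (Scheme.ΓSpecIso X.functionField).inv := by
      rw [Scheme.Hom.appLE, Scheme.fromSpecStalk_app hη]
      simp only [Category.assoc, ← Functor.map_comp]
      congr 1
    have h2 : (e ≫ g).appLE U ⊤ (by rw [Scheme.Hom.comp_preimage, htop]) =
        (X.fromSpecStalk (genericPoint X)).appLE U ⊤ hle := by
      simp only [he]
    dsimp only [j₀]
    rw [Scheme.Hom.app_eq_appLE, Scheme.Hom.appLE_comp_appLE_assoc, h2, h1, Category.assoc, Iso.inv_hom_id, Category.comp_id]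
  have hiso : IsIso j₀ := by
    have : IsIso (e.appLE (g ⁻¹ᵁ U) ⊤ htop.ge) := by
      rw [Scheme.Hom.appLE]
      have h2 : homOfLE htop.ge = eqToHom htop.symm := rfl
      rw [h2]
      infer_instance
    infer_instance
  let j : Γ(Z, g ⁻¹ᵁ U) →ₐ[Γ(X, U)] X.functionField := 
    { j₀.hom with commutes' := fun x => congr($hj x) }
  exact intClos_finite (k := k) j (ConcreteCategory.bijective_of_isIso j₀).1
end QFEnd

namespace QFEnd
open AlgebraicGeometry CategoryTheory CategoryTheory.Limits

lemma exists_lift {Z X : Scheme.{0}} (g : Z ⟶ X) [QuasiCompact g] [QuasiSeparated g]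
    (φ : X ⟶ X) (s : Z ⟶ Z) (hs : s ≫ g = g ≫ φ) :
    ∃ ψ : g.normalization ⟶ g.normalization, ψ ≫ g.fromNormalization = g.fromNormalization ≫ φ ∧
      g.toNormalization ≫ ψ = s ≫ g.toNormalization := by
  let P := pullback g.fromNormalization φ
  let f₁ : Z ⟶ P := pullback.lift (s ≫ g.toNormalization) g (by simp [hs])
  have H : g = f₁ ≫ pullback.snd g.fromNormalization φ := (pullback.lift_snd _ _ _).symm
  refine ⟨g.normalizationDesc f₁ (pullback.snd g.fromNormalization φ) H ≫ pullback.fst _ _, ?_, ?_⟩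
  · rw [Category.assoc, pullback.condition, Scheme.Hom.normalizationDesc_comp_assoc]
  · rw [Scheme.Hom.toNormalization_normalizationDesc_assoc]
    exact pullback.lift_fst _ _ _

lemma lift_openImmersion {Z X : Scheme.{0}} [IsIntegral Z] (g : Z ⟶ X) [QuasiCompact g] [QuasiSeparated g]
    (s : Z ⟶ Z) [IsIso s] (ψ : g.normalization ⟶ g.normalization)
    [LocallyQuasiFinite ψ] [LocallyOfFiniteType ψ] [IsSeparated ψ] [QuasiCompact ψ]
    (hψ : g.toNormalization ≫ ψ = s ≫ g.toNormalization) : IsOpenImmersion ψ := by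
  set ν := g.fromNormalization
  set ι := g.toNormalization
  let m := ψ.toNormalization
  let p := ψ.fromNormalization
  have hmp : m ≫ p = ψ := ψ.toNormalization_fromNormalization
  have H : g = (inv s ≫ ι ≫ m) ≫ (p ≫ ν) := by
    simp only [Category.assoc]
    rw [reassoc_of% hmp, reassoc_of% hψ]
    simp [ι, ν]
  let σ := g.normalizationDesc (inv s ≫ ι ≫ m) (p ≫ ν) H
  have h1 : ι ≫ σ = inv s ≫ ι ≫ m := g.toNormalization_normalizationDesc _ _ H
  have h2 : σ ≫ p ≫ ν = ν := g.normalizationDesc_comp _ _ H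
  have h3 : σ ≫ p = 𝟙 _ := by
    refine Scheme.Hom.normalization.hom_ext g _ _ ν ?_ ?_ ?_
    · change ι ≫ σ ≫ p = ι ≫ _
      rw [reassoc_of% h1, hmp, hψ]; simp
    · rw [Category.assoc, h2]
    · simp [ν]
  have h4 : ψ ≫ σ = m := by
    refine ext_of_isDominant_of_isSeparated p ?_ ι ?_
    · rw [Category.assoc, h3, hmp, Category.comp_id]
    · rw [reassoc_of% hψ, h1]; simp
  have h5 : p ≫ σ = 𝟙 _ := by
    refine Scheme.Hom.normalization.hom_ext ψ _ _ p ?_ ?_ ?_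
    · change m ≫ p ≫ σ = m ≫ _
      rw [reassoc_of% hmp, h4, Category.comp_id]
    · rw [Category.assoc, h3, Category.comp_id]
    · simp [p]
  have : IsIso p := ⟨σ, h5, h3⟩
  rw [← hmp]
  infer_instance

lemma residue_inj_of_isField {R : Type} [CommRing R] [IsLocalRing R] (h : IsField R) :
    Function.Injective (IsLocalRing.residue R) := by
  rw [injective_iff_map_eq_zero]
  intro a ha
  by_contra hne
  obtain ⟨b, hb⟩ := h.mul_inv_cancel hne
  have := congrArg (IsLocalRing.residue R) hb
  rw [map_mul, ha, zero_mul, map_one] at this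
  exact zero_ne_one this

lemma exists_normal_model {k : Type} [Field k] [IsAlgClosed k] [CharZero k] {X : Scheme.{0}} [IsIntegral X]
    (f : X ⟶ Spec (.of k)) [LocallyOfFiniteType f] [QuasiCompact f] [IsSeparated f]
    (φ : X ⟶ X) (hφ : φ ≫ f = f) [LocallyQuasiFinite φ]
    (e : φ (genericPoint X) = genericPoint X) (he : IsIso (φ.residueFieldMap (genericPoint X))) :
    ∃ (X' : Scheme.{0}) (ν : X' ⟶ X) (ψ : X' ⟶ X'), IsFinite ν ∧ IsDominant ν ∧ IsIso ψ ∧ IsIntegral X' ∧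
      ψ ≫ ν = ν ≫ φ := by
  let g := X.fromSpecResidueField (genericPoint X)
  have : QuasiCompact g := .of_comp g f
  have : QuasiSeparated g := .of_comp g f
  let s : Spec (X.residueField (genericPoint X)) ⟶ Spec (X.residueField (genericPoint X)) :=
    Spec.map (φ.residueFieldMap (genericPoint X)) ≫ Spec.map (X.residueFieldCongr e).inv
  have hs : s ≫ g = g ≫ φ := by
    dsimp only [s, g]
    rw [Category.assoc, ← Scheme.Hom.SpecMap_residueFieldMap_fromSpecResidueField]
    congr 1
    exact X.residueFieldCongr_fromSpecResidueField e.symm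
  have hres : IsIso (X.residue (genericPoint X)) := by
    have hF : IsField X.functionField := Field.toIsField _
    apply (ConcreteCategory.isIso_iff_bijective _).2
    exact ⟨residue_inj_of_isField hF, IsLocalRing.residue_surjective⟩
  obtain ⟨ψ, h1, h2⟩ := exists_lift g φ s hs
  have hfin : IsFinite g.fromNormalization := by
    refine normalization_finite f g (inv (Spec.map (X.residue (genericPoint X)))) ?_
    simp [g, Scheme.fromSpecResidueField]
  have hfφ : LocallyOfFiniteType φ := by
    have : LocallyOfFiniteType (φ ≫ f) := by rw [hφ]; infer_instance
    exact locallyOfFiniteType_of_comp φ f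
  have hψf : ψ ≫ (g.fromNormalization ≫ f) = g.fromNormalization ≫ f := by
    rw [reassoc_of% h1, hφ]
  have : LocallyQuasiFinite ψ := by
    have : LocallyQuasiFinite (ψ ≫ g.fromNormalization) := by rw [h1]; infer_instance
    exact .of_comp ψ g.fromNormalization
  have : LocallyOfFiniteType ψ := by
    have : LocallyOfFiniteType (ψ ≫ (g.fromNormalization ≫ f)) := by rw [hψf]; infer_instance
    exact locallyOfFiniteType_of_comp ψ (g.fromNormalization ≫ f)
  have : IsSeparated ψ := by
    have : IsSeparated (ψ ≫ (g.fromNormalization ≫ f)) := by rw [hψf]; infer_instance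
    exact .of_comp ψ (g.fromNormalization ≫ f)
  have : QuasiCompact ψ := by
    have : QuasiCompact (ψ ≫ (g.fromNormalization ≫ f)) := by rw [hψf]; infer_instance
    exact .of_comp ψ (g.fromNormalization ≫ f)
  have : IsIntegral (Spec (X.residueField (genericPoint X))) := inferInstance
  have : IsOpenImmersion ψ := lift_openImmersion g s ψ h2
  have hiso : IsIso ψ := isIso_of_isOpenImmersion (g.fromNormalization ≫ f) ψ hψf
  have hgd : IsDominant g := by
    refine ⟨?_⟩
    rw [DenseRange, X.range_fromSpecResidueField]
    exact dense_iff_closure_eq.2 (genericPoint_closure _)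
  have hdom : IsDominant g.fromNormalization := by
    have : IsDominant (g.toNormalization ≫ g.fromNormalization) := by
      rw [Scheme.Hom.toNormalization_fromNormalization]; exact hgd
    exact .of_comp g.toNormalization g.fromNormalization
  exact ⟨_, _, ψ, hfin, hdom, hiso, inferInstance, h1⟩
end QFEnd

namespace QFEnd
open AlgebraicGeometry CategoryTheory CategoryTheory.Limits

/-- Iterates of an endomorphism of a scheme. -/
noncomputable def iter {X : Scheme.{0}} (φ : X ⟶ X) : ℕ → (X ⟶ X)
  | 0 => 𝟙 X
  | n + 1 => φ ≫ iter φ n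

/-- The twisted parametrisations of a scheme by its normal model. -/
noncomputable def tw {X' X : Scheme.{0}} (ν : X' ⟶ X) (χ : X' ⟶ X') : ℕ → (X' ⟶ X)
  | 0 => ν
  | n + 1 => χ ≫ tw ν χ n

lemma tw_succ_comp {X' X : Scheme.{0}} (ν : X' ⟶ X) (χ : X' ⟶ X') (φ : X ⟶ X)
    (h : χ ≫ ν ≫ φ = ν) (n : ℕ) : tw ν χ (n + 1) ≫ φ = tw ν χ n := by
  induction n with
  | zero => simpa [tw] using h
  | succ n ih => 
    change (χ ≫ tw ν χ (n + 1)) ≫ φ = χ ≫ tw ν χ n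
    rw [Category.assoc, ih]

lemma tw_iter {X' X : Scheme.{0}} (ν : X' ⟶ X) (χ : X' ⟶ X') (φ : X ⟶ X)
    (h : χ ≫ ν ≫ φ = ν) (n : ℕ) : tw ν χ n ≫ iter φ n = ν := by
  induction n with
  | zero => simp [tw, iter]
  | succ n ih => 
    change tw ν χ (n + 1) ≫ φ ≫ iter φ n = ν
    rw [← Category.assoc, tw_succ_comp ν χ φ h, ih]

lemma appLE_inj {X Y : Scheme.{0}} [IsReduced Y] (a : X ⟶ Y) [IsDominant a] (V : Y.Opens) (W : X.Opens)
    (h : W = a ⁻¹ᵁ V) : Function.Injective (a.appLE V W h.le) := by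
  subst h
  rw [← Scheme.Hom.app_eq_appLE]
  rw [injective_iff_map_eq_zero]
  intro s hs
  rw [← basicOpen_eq_bot_iff]
  have h1 : a ⁻¹ᵁ Y.basicOpen s = ⊥ := by
    rw [Scheme.Hom.preimage_basicOpen, hs]
    simp
  by_contra hne
  have hn : (Y.basicOpen s : Set Y).Nonempty := by
    rw [Set.nonempty_iff_ne_empty]
    intro he
    exact hne (TopologicalSpace.Opens.ext he)
  obtain ⟨x, hx⟩ := a.denseRange.exists_mem_open (Y.basicOpen s).isOpen hn
  have : x ∈ a ⁻¹ᵁ Y.basicOpen s := hx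
  rw [h1] at this
  exact this

lemma chain_alg {R M : Type} [CommRing R] [CommRing M] [IsNoetherianRing R] (c : R →+* M) (hc : c.Finite)
    (A : ℕ → Type) [∀ n, CommRing (A n)] (i : ∀ n, R →+* A n) (p : ∀ n, A n →+* A (n + 1))
    (q : ∀ n, A n →+* M) (h1 : ∀ n, (q n).comp (i n) = c) (h2 : ∀ n, (q (n + 1)).comp (p n) = q n)
    (hq : ∀ n, Function.Injective (q n)) : ∃ N, ∀ n ≥ N, Function.Bijective (p n) := by
  let _ : Algebra R M := c.toAlgebra
  have : Module.Finite R M := hc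
  have : IsNoetherian R M := inferInstance
  let S : ℕ → Submodule R M := fun n => 
    { carrier := Set.range (q n)
      add_mem' := by rintro _ _ ⟨x, rfl⟩ ⟨y, rfl⟩; exact ⟨x + y, map_add _ _ _⟩
      zero_mem' := ⟨0, map_zero _⟩
      smul_mem' := by
        rintro r _ ⟨x, rfl⟩
        refine ⟨i n r * x, ?_⟩
        rw [map_mul, Algebra.smul_def]
        congr 1
        exact congr($(h1 n) r) }
  have hS : Monotone S := by
    refine monotone_nat_of_le_succ fun n => ?_
    rintro _ ⟨x, rfl⟩
    exact ⟨p n x, congr($(h2 n) x)⟩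
  obtain ⟨N, hN⟩ := monotone_stabilizes_iff_noetherian.2 this ⟨S, hS⟩
  refine ⟨N, fun n hn => ⟨?_, fun y => ?_⟩⟩
  · refine Function.Injective.of_comp (f := q (n + 1)) ?_
    rw [← RingHom.coe_comp, h2]
    exact hq n
  · have he : S (n + 1) = S n := (hN (n + 1) (by omega)).symm.trans (hN n hn)
    have hy : q (n + 1) y ∈ S (n + 1) := ⟨y, rfl⟩
    rw [he] at hy
    obtain ⟨x, hx⟩ := hy
    refine ⟨x, hq (n + 1) ?_⟩
    rw [← hx]
    exact congr($(h2 n) x)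

lemma chain_scheme {X' X : Scheme.{0}} [IsIntegral X] [IsLocallyNoetherian X] (ν : X' ⟶ X) [IsFinite ν]
    [IsDominant ν] (χ : X' ⟶ X') [IsIso χ] (φ : X ⟶ X) (h : χ ≫ ν ≫ φ = ν) (U : X.Opens)
    (hU : IsAffineOpen U) : ∃ N, ∀ n ≥ N, IsIso (φ.app (iter φ n ⁻¹ᵁ U)) := by
  have hdom : ∀ n, IsDominant (tw ν χ n) := by
    intro n
    induction n with
    | zero => assumption
    | succ n ih => exact inferInstanceAs (IsDominant (χ ≫ tw ν χ n))
  have hW : ∀ n, ν ⁻¹ᵁ U = tw ν χ n ⁻¹ᵁ (iter φ n ⁻¹ᵁ U) := fun n => by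
    rw [← Scheme.Hom.comp_preimage, tw_iter ν χ φ h]
  have : IsNoetherianRing Γ(X, U) := IsLocallyNoetherian.component_noetherian ⟨U, hU⟩
  obtain ⟨N, hN⟩ := chain_alg (ν.app U).hom (ν.finite_app U hU) (fun n => Γ(X, iter φ n ⁻¹ᵁ U))
    (fun n => ((iter φ n).app U).hom) (fun n => (φ.app (iter φ n ⁻¹ᵁ U)).hom)
    (fun n => ((tw ν χ n).appLE (iter φ n ⁻¹ᵁ U) (ν ⁻¹ᵁ U) (hW n).le).hom) 
    (fun n => by
      rw [← CommRingCat.hom_comp, Scheme.Hom.app_eq_appLE, Scheme.Hom.appLE_comp_appLE, Scheme.Hom.app_eq_appLE]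
      simp only [tw_iter ν χ φ h])
    (fun n => by
      rw [Scheme.Hom.app_eq_appLE]
      have := Scheme.Hom.appLE_comp_appLE (tw ν χ (n + 1)) φ (iter φ n ⁻¹ᵁ U) (φ ⁻¹ᵁ iter φ n ⁻¹ᵁ U) (ν ⁻¹ᵁ U) le_rfl (hW (n + 1)).le
      simp only [tw_succ_comp ν χ φ h] at this
      exact congr(($this).hom))
    (fun n => appLE_inj _ _ _ (hW n))
  exact ⟨N, fun n hn => (ConcreteCategory.isIso_iff_bijective _).2 (hN n hn)⟩

lemma isIso_of_cover {X : Scheme.{0}} [IsIntegral X] [IsLocallyNoetherian X] [CompactSpace X] {X' : Scheme.{0}}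
    (ν : X' ⟶ X) [IsFinite ν]
    [IsDominant ν] (χ : X' ⟶ X') [IsIso χ] (φ : X ⟶ X) [IsAffineHom φ] (h : χ ≫ ν ≫ φ = ν) : IsIso φ := by
  obtain ⟨s, hs, hcov⟩ := isCompact_iff_finite_and_eq_biUnion_affineOpens (U := (⊤ : X.Opens)) |>.mp isCompact_univ
  choose N hN using fun U : X.affineOpens => chain_scheme ν χ φ h U.1 U.2
  obtain ⟨n, hn⟩ : ∃ n, ∀ U ∈ s, N U ≤ n := by
    obtain ⟨n, hn⟩ := (hs.image N).bddAbove
    exact ⟨n, fun U hU => hn ⟨U, hU, rfl⟩⟩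
  have haff : ∀ n, IsAffineHom (iter φ n) := by
    intro n
    induction n with
    | zero => exact inferInstanceAs (IsAffineHom (𝟙 X))
    | succ n ih => exact inferInstanceAs (IsAffineHom (φ ≫ iter φ n))
  have hcov' : ⨆ i : s, iter φ n ⁻¹ᵁ i.1.1 = ⊤ := by
    have h2 : (⨆ i : s, i.1.1) = (⊤ : X.Opens) := by rw [hcov, iSup_subtype']
    rw [← Scheme.Hom.preimage_iSup, h2]
    rfl
  refine IsZariskiLocalAtTarget.of_iSup_eq_top (P := MorphismProperty.isomorphisms Scheme.{0})
    (fun i : s => iter φ n ⁻¹ᵁ i.1.1) hcov' (fun i => ?_)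
  have hV : IsAffineOpen (iter φ n ⁻¹ᵁ i.1.1) := i.1.2.preimage (iter φ n)
  have a1 : IsAffine (iter φ n ⁻¹ᵁ i.1.1).toScheme := hV
  have a2 : IsAffine (φ ⁻¹ᵁ iter φ n ⁻¹ᵁ i.1.1).toScheme := hV.preimage φ
  have a3 : IsIso (φ ∣_ (iter φ n ⁻¹ᵁ i.1.1)).appTop := by
    have h1 := hN i.1 n (hn i.1 i.2)
    rw [morphismRestrict_appTop]
    have he : (iter φ n ⁻¹ᵁ i.1.1).ι ''ᵁ ⊤ = iter φ n ⁻¹ᵁ i.1.1 := by simp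
    have h2 : IsIso (φ.app ((iter φ n ⁻¹ᵁ i.1.1).ι ''ᵁ ⊤)) := by rw [he]; exact h1
    refine IsIso.comp_isIso' h2 ?_
    have : ∀ {A B : X.Opens} (e : A = B), IsIso (X.presheaf.map (eqToHom e).op) := by
      rintro A _ rfl; simp only [eqToHom_refl, op_id, CategoryTheory.Functor.map_id]; infer_instance
    exact this _
  refine ((MorphismProperty.isomorphisms _).arrow_mk_iso_iff (arrowIsoSpecΓOfIsAffine _)).mpr ?_
  exact inferInstanceAs (IsIso (Spec.map (φ ∣_ (iter φ n ⁻¹ᵁ i.1.1)).appTop))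
end QFEnd


open AlgebraicGeometry CategoryTheory

/-- A quasi-finite (all fibers finite) endomorphism of an algebraic variety
over an algebraically closed field of characteristic zero that is injective off a proper
closed subvariety is an automorphism. -/
theorem quasiFinite_endomorphism_injective_off_subvariety_isAutomorphism
    (k : Type) [Field k] [IsAlgClosed k] [CharZero k]
    (X : Scheme) [IsIntegral X]
    (f : X ⟶ Spec (CommRingCat.of k)) [LocallyOfFiniteType f] [QuasiCompact f]
    [IsSeparated f]
    (φ : X ⟶ X) (hφ : φ ≫ f = f)
    (hqf : ∀ y : X, (φ.base ⁻¹' {y}).Finite)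
    (Y : Set X) (hYcl : IsClosed Y) (hYirr : IsIrreducible Y) (hYne : Y ≠ Set.univ)
    (hinj : Set.InjOn φ.base Yᶜ) :
    IsIso φ := by
  have hft : LocallyOfFiniteType φ := by
    have : LocallyOfFiniteType (φ ≫ f) := by rw [hφ]; infer_instance
    exact locallyOfFiniteType_of_comp φ f
  have hsep : IsSeparated φ := by
    have : IsSeparated (φ ≫ f) := by rw [hφ]; infer_instance
    exact .of_comp φ f
  have hqc : QuasiCompact φ := by
    have : QuasiCompact (φ ≫ f) := by rw [hφ]; infer_instance
    exact .of_comp φ f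
  have hlqf : LocallyQuasiFinite φ := LocallyQuasiFinite.of_finite_preimage_singleton φ hqf
  have e := QFEnd.generic_fixed k X f φ
  let U : X.Opens := ⟨Yᶜ, hYcl.isOpen_compl⟩
  have hη : genericPoint X ∈ U := by
    refine ((genericPoint_spec X).mem_open_set_iff U.isOpen).mpr ?_
    rw [Set.univ_inter]
    exact Set.nonempty_compl.2 hYne
  have he : IsIso (φ.residueFieldMap (genericPoint X)) :=
    QFEnd.residueFieldMap_bijective f φ hφ U hinj _ hη
  obtain ⟨X', ν, ψ, hfin, hdom, hψ, -, hcomm⟩ := QFEnd.exists_normal_model f φ hφ e he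
  have hsurj : Surjective ν := by
    refine ⟨Set.range_eq_univ.1 ?_⟩
    rw [← ν.isClosedMap.isClosed_range.closure_eq]
    exact ν.denseRange.closure_range
  have huc : UniversallyClosed φ := by
    have : UniversallyClosed (ν ≫ φ) := by rw [← hcomm]; infer_instance
    exact .of_comp_surjective ν φ
  have hprop : IsProper φ := ⟨⟩
  have hfinφ : IsFinite φ := IsFinite.of_isProper_of_locallyQuasiFinite φ
  have hN : IsLocallyNoetherian X := LocallyOfFiniteType.isLocallyNoetherian f
  have hcpt : CompactSpace X := (quasiCompact_iff_compactSpace (f := f)).1 inferInstance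
  exact QFEnd.isIso_of_cover ν (inv ψ) φ (by rw [← hcomm]; simp)
end

section
/- Let X be a normal integral algebraic variety over an algebraically closed field of characteristic zero and φ : X → X a quasi-finite birational endomorphism. Then φ is injective, and hence an automorphism. -/
open AlgebraicGeometry CategoryTheory


namespace AxDef
open FirstOrder Language FirstOrder.Field FirstOrder.Ring BoundedFormula

variable {β : Type} [Finite β] {γ : Type} [Finite γ]

def rho (i j : Fin 3) : γ ⊕ (β ⊕ β) → γ ⊕ (Fin 3 × β) :=
  Sum.map id (Sum.elim (fun b => (i, b)) (fun b => (j, b)))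

noncomputable def eqF (i j : Fin 3) : ring.Formula (γ ⊕ (Fin 3 × β)) :=
  Formula.iInf (fun b : β => Term.equal (.var (.inr (i, b))) (.var (.inr (j, b))))

noncomputable def fA (φ : ring.Formula (γ ⊕ (β ⊕ β))) : ring.Formula γ :=
  Formula.iAlls (Fin 3 × β)
    ((φ.relabel (rho 0 1)).imp ((φ.relabel (rho 0 2)).imp (eqF 1 2)))

noncomputable def fB (φ : ring.Formula (γ ⊕ (β ⊕ β))) : ring.Formula γ :=
  Formula.iAlls (Fin 3 × β)
    ((φ.relabel (rho 0 2)).imp ((φ.relabel (rho 1 2)).imp (eqF 0 1)))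

noncomputable def fC (φ : ring.Formula (γ ⊕ (β ⊕ β))) : ring.Formula γ :=
  Formula.iAlls (Fin 3 × β)
    ((φ.relabel (rho 0 1)).imp (Formula.iExs β (φ.relabel
      (Sum.elim (fun c => .inl (.inl c))
        (Sum.elim (fun b => .inl (.inr (1, b))) (fun b => .inr b))))))

noncomputable def fD (φ : ring.Formula (γ ⊕ (β ⊕ β))) : ring.Formula γ :=
  Formula.iAlls (Fin 3 × β)
    ((φ.relabel (rho 0 1)).imp (Formula.iExs β (φ.relabel
      (Sum.elim (fun c => .inl (.inl c))
        (Sum.elim (fun b => .inr b) (fun b => .inl (.inr (0, b))))))))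

noncomputable def sent (φ : ring.Formula (γ ⊕ (β ⊕ β))) : ring.Sentence :=
  Formula.iAlls γ (((fA φ).imp ((fB φ).imp ((fC φ).imp (fD φ)))).relabel Sum.inr)

/-- The property of a graph. -/
def Prop' {K : Type} (G : (β → K) → (β → K) → Prop) : Prop :=
  (∀ x y z, G x y → G x z → y = z) → (∀ x y z, G x z → G y z → x = y) →
  (∀ x y, G x y → ∃ z, G y z) → (∀ x y, G x y → ∃ z, G z x)

lemma forall3 {K : Type} (P : (Fin 3 × β → K) → Prop) :
    (∀ v, P v) ↔ ∀ x y z : β → K, P (fun p => (![x, y, z] p.1) p.2) := by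
  constructor
  · intro h x y z; exact h _
  · intro h v
    convert h (fun b => v (0, b)) (fun b => v (1, b)) (fun b => v (2, b)) using 1
    ext ⟨i, b⟩
    fin_cases i <;> rfl

lemma realize_sent {K : Type} [Field K] [CompatibleRing K] (φ : ring.Formula (γ ⊕ (β ⊕ β))) :
    (K ⊨ sent φ) ↔ ∀ c : γ → K,
      Prop' (fun x y : β → K => φ.Realize (Sum.elim c (Sum.elim x y))) := by
  have e1 : ∀ (c : γ → K) (v : Fin 3 × β → K) (i j : Fin 3),
      (Sum.elim c v ∘ rho i j) =
        Sum.elim c (Sum.elim (fun b => v (i, b)) (fun b => v (j, b))) := by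
    intro c v i j
    ext (a | a | a) <;> rfl
  have e2 : ∀ (c : γ → K) (v : Fin 3 × β → K) (w : β → K) ,
      (Sum.elim (Sum.elim c v) w ∘ (Sum.elim (fun c => .inl (.inl c))
        (Sum.elim (fun b => .inl (.inr (1, b))) (fun b => .inr b)))) =
        Sum.elim c (Sum.elim (fun b => v (1, b)) w) := by
    intro c v i 
    ext (a | a | a) <;> rfl
  have e3 : ∀ (c : γ → K) (v : Fin 3 × β → K) (w : β → K) ,
      (Sum.elim (Sum.elim c v) w ∘ (Sum.elim (fun c => .inl (.inl c))
        (Sum.elim (fun b => .inr b) (fun b => .inl (.inr (0, b)))))) =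
        Sum.elim c (Sum.elim w (fun b => v (0, b))) := by
    intro c v i 
    ext (a | a | a) <;> rfl
  have e4 : ∀ c : γ → K, (Sum.elim (default : Empty → K) c ∘ Sum.inr) = c := by
    intro c; rfl
  simp only [Sentence.Realize, sent, Formula.realize_iAlls, Formula.realize_relabel,
    Formula.realize_imp, fA, fB, fC, fD, Formula.realize_iExs, e1, e2, e3, e4, eqF,
    Formula.realize_iInf, Formula.realize_equal, Term.realize_var, Sum.elim_inr, Prop',
    forall3, funext_iff]
  simp

lemma autInv {K : Type} [Field K] [CompatibleRing K] {α : Type} (φ : ring.Formula α)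
    (σ : K ≃+* K) (v : α → K) : φ.Realize (σ ∘ v) ↔ φ.Realize v := by
  let e : ring.Equiv K K := languageEquivEquivRingEquiv.symm σ
  have := StrongHomClass.realize_formula e φ (v := v)
  exact this

lemma propBar (p : ℕ) [Fact p.Prime] {K : Type} [Field K] [IsAlgClosed K] [CompatibleRing K] [Algebra (ZMod p) K]
    [Algebra.IsAlgebraic (ZMod p) K]
    (φ : ring.Formula (γ ⊕ (β ⊕ β))) (c : γ → K) :
    Prop' (fun x y : β → K => φ.Realize (Sum.elim c (Sum.elim x y))) := by
  intro hA hB hC x y hxy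
  let F := IntermediateField.adjoin (ZMod p) (Set.range c ∪ Set.range x)
  have : FiniteDimensional (ZMod p) F := by
    apply IntermediateField.finiteDimensional_adjoin
    · intro a _; exact Algebra.IsIntegral.isIntegral a
  have : Finite F := Module.finite_of_finite (ZMod p)
  have : IsGalois F K := by
    have : Algebra.IsAlgebraic F K := Algebra.IsAlgebraic.tower_top (K := ZMod p) F
    have : IsAlgClosure F K := ⟨inferInstance, inferInstance⟩
    infer_instance
  have key : ∀ x y : β → K, (∀ b, x b ∈ F) → φ.Realize (Sum.elim c (Sum.elim x y)) →
      ∀ b, y b ∈ F := by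
    intro x y hx h b
    have : y b ∈ (⊥ : IntermediateField F K) := by
      rw [InfiniteGalois.mem_bot_iff_fixed]
      intro σ
      have hσ : ∀ z ∈ F, σ z = z := fun z hz => σ.commutes ⟨z, hz⟩
      have h' := (autInv φ σ.toRingEquiv _).2 h
      have : (σ.toRingEquiv ∘ (Sum.elim c (Sum.elim x y))) = Sum.elim c (Sum.elim x (σ ∘ y)) := by
        ext (a | a | a)
        · exact hσ _ (IntermediateField.subset_adjoin _ _ (.inl ⟨a, rfl⟩))
        · exact hσ _ (hx a)
        · rfl
      rw [this] at h'
      exact congrFun (hA _ _ _ h' h) b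
    obtain ⟨z, hz⟩ := IntermediateField.mem_bot.1 this
    rw [← hz]
    exact z.2
  let S : Type := {z : β → F // ∃ w : β → K, φ.Realize (Sum.elim c (Sum.elim (fun b => (z b : K)) w))}
  have : Finite S := Subtype.finite
  have hex : ∀ s : S, ∃ t : S, φ.Realize (Sum.elim c (Sum.elim (fun b => (s.1 b : K)) (fun b => (t.1 b : K)))) := by
    rintro ⟨z, w, hw⟩
    refine ⟨⟨fun b => ⟨w b, key _ _ (fun b => (z b).2) hw b⟩, hC _ _ hw⟩, hw⟩
  choose g hg using hex
  have hinj : Function.Injective g := by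
    intro s t hst
    have h1 := hg s
    rw [hst] at h1
    have := hB _ _ _ h1 (hg t)
    ext b
    exact congrFun this b
  have hx : ∀ b, x b ∈ F := fun b => IntermediateField.subset_adjoin _ _ (.inr ⟨b, rfl⟩)
  obtain ⟨s, hs⟩ := Finite.surjective_of_injective hinj ⟨fun b => ⟨x b, hx b⟩, y, hxy⟩
  have := hg s
  rw [hs] at this
  exact ⟨_, this⟩

lemma sent_prime {p : ℕ} (hp : p.Prime) (φ : ring.Formula (γ ⊕ (β ⊕ β))) :
    Theory.ACF p ⊨ᵇ sent φ := by
  have : Fact p.Prime := ⟨hp⟩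
  let := compatibleRingOfRing (AlgebraicClosure (ZMod p))
  rw [← (ACF_isComplete (Or.inl hp)).realize_sentence_iff _
    (AlgebraicClosure (ZMod p)), realize_sent]
  exact propBar p φ

lemma sent_zero (φ : ring.Formula (γ ⊕ (β ⊕ β))) : Theory.ACF 0 ⊨ᵇ sent φ := by
  rw [ACF_zero_realize_iff_infinite_ACF_prime_realize]
  convert! Set.infinite_univ (α := Nat.Primes)
  rw [Set.eq_univ_iff_forall]
  intro ⟨p, hp⟩
  exact sent_prime hp φ

theorem ax_definable {K : Type} [Field K] [IsAlgClosed K] [CharZero K] [CompatibleRing K]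
    {T : Type} (e : T → β → K) (he : Function.Injective e) (g : T → T)
    (hg : Function.Injective g)
    (hdef : (Set.univ : Set K).Definable ring
      {z : β ⊕ β → K | ∃ t, z = Sum.elim (e t) (e (g t))}) : Function.Surjective g := by
  rw [Set.definable_iff_finitely_definable] at hdef
  rcases hdef with ⟨c, _, hS⟩
  rw [Set.definable_iff_exists_formula_sum] at hS
  rcases hS with ⟨φ, hφ⟩
  have := sent_zero φ
  rw [← (ACF_isComplete (.inr rfl)).realize_sentence_iff _ K, realize_sent] at this
  have := this Subtype.val
  have hG : ∀ x y : β → K, φ.Realize (Sum.elim Subtype.val (Sum.elim x y)) ↔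
      ∃ t, x = e t ∧ y = e (g t) := by
    intro x y
    have := Set.ext_iff.1 hφ (Sum.elim x y)
    simp only [Set.mem_ofPred_eq] at this
    refine Iff.trans this.symm ?_
    simp only [Sum.elim_eq_iff]
  simp only [hG] at this
  intro t
  have h1 : ∀ x y z : β → K, (∃ t, x = e t ∧ y = e (g t)) → (∃ t, x = e t ∧ z = e (g t)) →
      y = z := by
    rintro x y z ⟨s, rfl, rfl⟩ ⟨t, h, rfl⟩
    rw [he h]
  have h2 : ∀ x y z : β → K, (∃ t, x = e t ∧ z = e (g t)) → (∃ t, y = e t ∧ z = e (g t)) →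
      x = y := by
    rintro x y z ⟨s, rfl, rfl⟩ ⟨t, rfl, h⟩
    rw [hg (he h)]
  have h3 : ∀ x y : β → K, (∃ t, x = e t ∧ y = e (g t)) → ∃ z, ∃ t, y = e t ∧ z = e (g t) := by
    rintro x y ⟨s, rfl, rfl⟩
    exact ⟨_, g s, rfl, rfl⟩
  obtain ⟨z, s, hs, h⟩ := this h1 h2 h3 (e t) (e (g t)) ⟨t, rfl, rfl⟩
  exact ⟨s, (he h).symm⟩

end AxDef

namespace AxGeom
open FirstOrder Language FirstOrder.Ring

variable {k : Type} [Field k] {X : Scheme.{0}} (f : X ⟶ Spec (CommRingCat.of k))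

/-- the closed point -/
def pt0 (k : Type) [Field k] : Spec (CommRingCat.of k) := IsLocalRing.closedPoint k

lemma le_pre (W : X.Opens) : W ≤ f ⁻¹ᵁ ⊤ := le_top

/-- evaluation at a `k`-point -/
noncomputable def ev (p : Spec (CommRingCat.of k) ⟶ X) (W : X.Opens)
    (h : p (pt0 k) ∈ W) : Γ(X, W) ⟶ CommRingCat.of k :=
  p.appLE W ⊤ (fun x _ => by
    have : x = pt0 k := Subsingleton.elim (α := PrimeSpectrum k) _ _
    rw [this]; exact h) ≫ (Scheme.ΓSpecIso (CommRingCat.of k)).hom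

/-- constants -/
noncomputable def cst (W : X.Opens) : CommRingCat.of k ⟶ Γ(X, W) :=
  (Scheme.ΓSpecIso (CommRingCat.of k)).inv ≫ f.appLE ⊤ W (le_pre f W)

lemma ev_res (p : Spec (CommRingCat.of k) ⟶ X) {W W' : X.Opens} (hle : W' ≤ W)
    (h : p (pt0 k) ∈ W') :
    X.presheaf.map (homOfLE hle).op ≫ ev p W' h = ev p W (hle h) := by
  simp [ev]

lemma ev_comp (p : Spec (CommRingCat.of k) ⟶ X) (φ : X ⟶ X) {W : X.Opens}
    (h : p (pt0 k) ∈ φ ⁻¹ᵁ W) :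
    φ.app W ≫ ev p (φ ⁻¹ᵁ W) h = ev (p ≫ φ) W (by rw [Scheme.Hom.comp_apply]; exact h) := by
  simp [ev, Scheme.Hom.comp_appLE]

lemma cst_ev (p : Spec (CommRingCat.of k) ⟶ X) (hp : p ≫ f = 𝟙 _) {W : X.Opens}
    (h : p (pt0 k) ∈ W) : cst f W ≫ ev p W h = 𝟙 _ := by
  simp only [cst, ev, Category.assoc]
  rw [Scheme.Hom.appLE_comp_appLE_assoc, hp]
  have : Scheme.Hom.appLE (𝟙 (Spec (CommRingCat.of k))) ⊤ ⊤ le_top = 𝟙 _ := by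
    exact (Scheme.Hom.appLE_eq_app (f := 𝟙 (Spec (CommRingCat.of k))) (U := ⊤)).trans (Scheme.Hom.id_app _)
  rw [this]
  exact (Scheme.ΓSpecIso (CommRingCat.of k)).inv_hom_id

lemma ev_fromSpec (p : Spec (CommRingCat.of k) ⟶ X) {W : X.Opens} (hW : IsAffineOpen W)
    (h : p (pt0 k) ∈ W) : Spec.map (ev p W h) ≫ hW.fromSpec = p := by
  simp only [ev, Spec.map_comp, Category.assoc]
  rw [IsAffineOpen.SpecMap_appLE_fromSpec p hW (isAffineOpen_top _), IsAffineOpen.fromSpec_top,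
    Scheme.isoSpec_Spec]
  simp

lemma exists_pt {W : X.Opens} (hW : IsAffineOpen W) (χ : Γ(X, W) ⟶ CommRingCat.of k)
    (hχ : cst f W ≫ χ = 𝟙 _) :
    ∃ (p : Spec (CommRingCat.of k) ⟶ X) (h : p (pt0 k) ∈ W), p ≫ f = 𝟙 _ ∧
      ev p W h = χ := by
  have h : (Spec.map χ ≫ hW.fromSpec) (pt0 k) ∈ W := by
    have : hW.fromSpec (Spec.map χ (pt0 k)) ∈ (W : Set X) := by
      rw [← hW.range_fromSpec]
      exact ⟨_, rfl⟩
    rw [Scheme.Hom.comp_apply]; exact this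
  refine ⟨Spec.map χ ≫ hW.fromSpec, h, ?_, ?_⟩
  · rw [Category.assoc, ← IsAffineOpen.SpecMap_appLE_fromSpec f (isAffineOpen_top _) hW (le_pre f W),
      IsAffineOpen.fromSpec_top, Scheme.isoSpec_Spec]
    have : Spec.map (cst f W ≫ χ) = 𝟙 _ := by rw [hχ]; simp
    simpa [cst] using this
  · apply Spec.map_injective
    rw [← cancel_mono hW.fromSpec, ev_fromSpec]

/-- the image of the `k`-points of `W` under the regular functions `s` -/
def img {β : Type} (W : X.Opens) (s : β → Γ(X, W)) : Set (β → k) :=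
  {z | ∃ (p : Spec (CommRingCat.of k) ⟶ X) (_ : p ≫ f = 𝟙 _)
    (h : p (pt0 k) ∈ W), ∀ b, z b = (ev p W h).hom (s b)}

lemma cst_finiteType [LocallyOfFiniteType f] {W : X.Opens} (hW : IsAffineOpen W) :
    (cst f W).hom.FiniteType := by
  have h1 := f.finiteType_appLE (isAffineOpen_top _) hW (le_pre f W)
  rw [cst, CommRingCat.hom_comp]
  exact h1.comp (RingHom.FiniteType.of_surjective _
    (ConcreteCategory.bijective_of_isIso (Scheme.ΓSpecIso (CommRingCat.of k)).inv).2)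

lemma img_affine [CompatibleRing k] [LocallyOfFiniteType f] {β : Type} [Finite β] {W : X.Opens}
    (hW : IsAffineOpen W) (s : β → Γ(X, W)) :
    (Set.univ : Set k).Definable ring (img f W s) := by
  have hft := cst_finiteType f hW
  let : Algebra k Γ(X, W) := (cst f W).hom.toAlgebra
  have hft : Algebra.FiniteType k Γ(X, W) := hft
  obtain ⟨n, π, hπ⟩ := Algebra.FiniteType.iff_quotient_mvPolynomial''.1 hft
  let a : Fin n ⊕ β → Γ(X, W) := Sum.elim (fun i => π (MvPolynomial.X i)) s
  let ψ : MvPolynomial (Fin n ⊕ β) k →ₐ[k] Γ(X, W) := MvPolynomial.aeval a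
  have hψ : Function.Surjective ψ := by
    intro y
    obtain ⟨q, rfl⟩ := hπ y
    refine ⟨MvPolynomial.rename Sum.inl q, ?_⟩
    have : (ψ.comp (MvPolynomial.rename Sum.inl)) = π := by
      ext i; simp [ψ, a]
    exact DFunLike.congr_fun this q
  obtain ⟨S, hS⟩ : (RingHom.ker ψ).FG := IsNoetherian.noetherian _
  have hdef := (mvPolynomial_zeroLocus_definable S).mono (Set.subset_univ _)
  rw [hS] at hdef
  have key : MvPolynomial.zeroLocus k (RingHom.ker ψ) = img f W a := by
    ext z
    constructor
    · intro hz
      let χ0 : Γ(X, W) →ₐ[k] k := Ideal.Quotient.liftₐ _ (MvPolynomial.aeval z) (fun q hq => hz q hq) |>.comp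
        (Ideal.quotientKerAlgEquivOfSurjective hψ).symm.toAlgHom
      have hχ0 : ∀ q, χ0 (ψ q) = MvPolynomial.aeval z q := by
        intro q
        have : (Ideal.quotientKerAlgEquivOfSurjective hψ).symm (ψ q) = Ideal.Quotient.mk _ q := by
          rw [AlgEquiv.symm_apply_eq]; rfl
        simp [χ0, this]
      obtain ⟨p, h, hp, hev⟩ := exists_pt f hW (CommRingCat.ofHom χ0.toRingHom) (by
        ext c
        exact χ0.commutes c)
      refine ⟨p, hp, h, fun b => ?_⟩
      rw [hev]
      have := hχ0 (MvPolynomial.X b)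
      simp only [ψ, MvPolynomial.aeval_X] at this
      exact this.symm
    · rintro ⟨p, hp, h, hz⟩ q hq
      let χ0 : Γ(X, W) →ₐ[k] k := { (ev p W h).hom with
        commutes' := fun c => by
          have := cst_ev f p hp h
          exact ConcreteCategory.congr_hom this c }
      have : (χ0.comp ψ) = MvPolynomial.aeval z := by
        ext i
        simp only [ψ, AlgHom.comp_apply, MvPolynomial.aeval_X]
        exact (hz i).symm
      rw [← this, AlgHom.comp_apply, (RingHom.mem_ker).1 hq, map_zero]
  rw [key] at hdef
  convert hdef.image_comp (Sum.inr : β → Fin n ⊕ β) using 1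
  ext z
  constructor
  · rintro ⟨p, hp, h, hz⟩
    exact ⟨fun b => (ev p W h).hom (a b), ⟨p, hp, h, fun _ => rfl⟩, funext fun b => (hz b).symm⟩
  · rintro ⟨y, ⟨p, hp, h, hz⟩, rfl⟩
    exact ⟨p, hp, h, fun b => hz (Sum.inr b)⟩

lemma img_compact [CompatibleRing k] [LocallyOfFiniteType f] {β : Type} [Finite β] {W : X.Opens}
    (hW : IsCompact (W : Set X)) (s : β → Γ(X, W)) :
    (Set.univ : Set k).Definable ring (img f W s) := by
  obtain ⟨F, hF, hWF⟩ := isCompact_iff_finite_and_eq_biUnion_affineOpens.1 hW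
  have hle : ∀ i : F, i.1.1 ≤ W := fun i => by
    rw [hWF]; exact le_iSup₂_of_le i.1 i.2 le_rfl
  have : Finite F := hF
  have : img f W s = ⋃ i : F, img f i.1.1 (fun b => (X.presheaf.map (homOfLE (hle i)).op).hom (s b)) := by
    ext z
    simp only [Set.mem_iUnion]
    constructor
    · rintro ⟨p, hp, h, hz⟩
      have h' := h
      rw [hWF] at h'
      simp only [TopologicalSpace.Opens.mem_iSup] at h'
      obtain ⟨i, hi, h'⟩ := h'
      refine ⟨⟨i, hi⟩, p, hp, h', fun b => ?_⟩
      rw [hz b, ← ev_res p (hle ⟨i, hi⟩) h']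
      rfl
    · rintro ⟨i, p, hp, h, hz⟩
      refine ⟨p, hp, hle i h, fun b => ?_⟩
      rw [hz b, ← ev_res p (hle i) h]
      rfl
  rw [this]
  exact Set.definable_iUnion_of_finite fun i => img_affine f i.1.2 _

/-- generators separate points -/
lemma ev_inj {W : X.Opens} (hW : IsAffineOpen W) {B : Type} (a : B → Γ(X, W))
    (ha : ∀ (χ χ' : Γ(X, W) ⟶ CommRingCat.of k), cst f W ≫ χ = 𝟙 _ → cst f W ≫ χ' = 𝟙 _ →
      (∀ b, χ.hom (a b) = χ'.hom (a b)) → χ = χ')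
    (p q : Spec (CommRingCat.of k) ⟶ X) (hp : p ≫ f = 𝟙 _) (hq : q ≫ f = 𝟙 _)
    (h : p (pt0 k) ∈ W) (h' : q (pt0 k) ∈ W)
    (heq : ∀ b, (ev p W h).hom (a b) = (ev q W h').hom (a b)) : p = q := by
  rw [← ev_fromSpec p hW h, ← ev_fromSpec q hW h',
    ha _ _ (cst_ev f p hp h) (cst_ev f q hq h') heq]

lemma exists_gens [LocallyOfFiniteType f] {W : X.Opens} (hW : IsAffineOpen W) :
    ∃ (n : ℕ) (a : Fin n → Γ(X, W)),
      ∀ (χ χ' : Γ(X, W) ⟶ CommRingCat.of k), cst f W ≫ χ = 𝟙 _ → cst f W ≫ χ' = 𝟙 _ →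
      (∀ b, χ.hom (a b) = χ'.hom (a b)) → χ = χ' := by
  have hft := cst_finiteType f hW
  let : Algebra k Γ(X, W) := (cst f W).hom.toAlgebra
  have hft : Algebra.FiniteType k Γ(X, W) := hft
  obtain ⟨n, π, hπ⟩ := Algebra.FiniteType.iff_quotient_mvPolynomial''.1 hft
  refine ⟨n, fun i => π (MvPolynomial.X i), fun χ χ' h h' heq => ?_⟩
  have hc : χ.hom.comp (π : MvPolynomial (Fin n) k →+* Γ(X, W)) = χ'.hom.comp π := by
    apply MvPolynomial.ringHom_ext
    · intro c
      have h1 : (π (MvPolynomial.C c)) = (cst f W).hom c := π.commutes c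
      simp only [RingHom.comp_apply, RingHom.coe_coe, h1]
      exact (ConcreteCategory.congr_hom h c).trans (ConcreteCategory.congr_hom h' c).symm
    · exact heq
  ext y
  obtain ⟨q, rfl⟩ := hπ y
  exact DFunLike.congr_fun hc q

end AxGeom

namespace AxGeom
open FirstOrder Language FirstOrder.Ring

/-- pair of encodings, as functions on `W` -/
noncomputable def pairing {k : Type} [Field k] {X : Scheme.{0}} (f : X ⟶ Spec (CommRingCat.of k))
    (φ : X ⟶ X) {W U U' : X.Opens} (h : W ≤ U) (h' : W ≤ φ ⁻¹ᵁ U') {B : Type} (c c' : k)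
    (a : B → Γ(X, U)) (a' : B → Γ(X, U')) : Option B ⊕ Option B → Γ(X, W) :=
  Sum.elim
    (fun o => o.elim ((cst f W).hom c) (fun b => (X.presheaf.map (homOfLE h).op).hom (a b)))
    (fun o => o.elim ((cst f W).hom c')
      (fun b => (X.presheaf.map (homOfLE h').op).hom ((φ.app U').hom (a' b))))

/-- encoding of a point -/
noncomputable def enc {k : Type} [Field k] {X : Scheme.{0}} {U : X.Opens} {B : Type} (c : k)
    (a : B → Γ(X, U)) (p : Spec (CommRingCat.of k) ⟶ X) (h : p (pt0 k) ∈ U) : Option B → k :=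
  fun o => o.elim c (fun b => (ev p U h).hom (a b))

lemma ev_pairing {k : Type} [Field k] {X : Scheme.{0}} (f : X ⟶ Spec (CommRingCat.of k))
    (φ : X ⟶ X) {W U U' : X.Opens} (h : W ≤ U) (h' : W ≤ φ ⁻¹ᵁ U') {B : Type} (c c' : k)
    (a : B → Γ(X, U)) (a' : B → Γ(X, U')) (p : Spec (CommRingCat.of k) ⟶ X) (hp : p ≫ f = 𝟙 _)
    (hW : p (pt0 k) ∈ W) (o) :
    (ev p W hW).hom (pairing f φ h h' c c' a a' o) =
      Sum.elim (enc c a p (h hW)) (enc c' a' (p ≫ φ)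
        (by rw [Scheme.Hom.comp_apply]; exact h' hW)) o := by
  have hc := fun c => ConcreteCategory.congr_hom (cst_ev f p hp hW) c
  rcases o with (_ | b) | (_ | b)
  · exact hc c
  · exact ConcreteCategory.congr_hom (ev_res p h hW) (a b)
  · exact hc c'
  · refine (ConcreteCategory.congr_hom (ev_res p h' hW) ((φ.app U').hom (a' b))).trans ?_
    exact ConcreteCategory.congr_hom (ev_comp p φ (W := U') (h' hW)) (a' b)

theorem points_surjective {k : Type} [Field k] [IsAlgClosed k] [CharZero k] {X : Scheme.{0}}
    (f : X ⟶ Spec (CommRingCat.of k)) [LocallyOfFiniteType f] [QuasiCompact f]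
    (φ : X ⟶ X) (hφ : φ ≫ f = f) [Mono φ] (q : Spec (CommRingCat.of k) ⟶ X) (hq : q ≫ f = 𝟙 _) :
    ∃ p : Spec (CommRingCat.of k) ⟶ X, p ≫ f = 𝟙 _ ∧ p ≫ φ = q := by
  let := compatibleRingOfRing k
  have : CompactSpace X := QuasiCompact.compactSpace_of_compactSpace f
  have : IsNoetherian X := { __ := LocallyOfFiniteType.isLocallyNoetherian f }
  have hcpt : ∀ W : X.Opens, IsCompact (W : Set X) := fun W =>
    TopologicalSpace.NoetherianSpace.isCompact _
  obtain ⟨F, hF, hXF⟩ := isCompact_iff_finite_and_eq_biUnion_affineOpens.1 (hcpt ⊤)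
  have : Finite F := hF
  obtain ⟨N, ⟨eF⟩⟩ := Finite.exists_equiv_fin F
  let U : Fin N → X.Opens := fun i => (eF.symm i).1.1
  have hU : ∀ i, IsAffineOpen (U i) := fun i => (eF.symm i).1.2
  have hcov : ∀ x : X, ∃ i, x ∈ U i := by
    intro x
    have : x ∈ (⊤ : X.Opens) := trivial
    rw [hXF] at this
    simp only [TopologicalSpace.Opens.mem_iSup] at this
    obtain ⟨i, hi, h⟩ := this
    exact ⟨eF ⟨i, hi⟩, by simpa [U] using h⟩
  let V : Fin N → X.Opens := fun i => ⨆ l : {l : Fin N // l < i}, U l.1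
  have hV : ∀ x i, x ∈ V i ↔ ∃ l < i, x ∈ U l := by
    intro x i
    simp [V]
  have hidx : ∀ x : X, ∃ i, x ∈ U i ∧ x ∉ V i := by
    intro x
    obtain ⟨i, hi, hmin⟩ := WellFounded.has_min (wellFounded_lt (α := Fin N)) {i | x ∈ U i} (hcov x)
    refine ⟨i, hi, fun h => ?_⟩
    obtain ⟨l, hl, h⟩ := (hV x i).1 h
    exact hmin l h hl
  choose idx hidxU hidxV using hidx
  have huniq : ∀ x i, x ∈ U i → x ∉ V i → idx x = i := by
    intro x i h h'
    rcases lt_trichotomy (idx x) i with hl | hl | hl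
    · exact (h' ((hV x i).2 ⟨_, hl, hidxU x⟩)).elim
    · exact hl
    · exact (hidxV x ((hV x _).2 ⟨_, hl, h⟩)).elim
  choose n a0 ha0 using fun i => exists_gens f (hU i)
  let B := Σ i, Fin (n i)
  let a : ∀ i, B → Γ(X, U i) := fun i b => if h : b.1 = i then a0 i (h ▸ b.2) else 0
  have ha : ∀ i, ∀ (χ χ' : Γ(X, U i) ⟶ CommRingCat.of k), cst f (U i) ≫ χ = 𝟙 _ →
      cst f (U i) ≫ χ' = 𝟙 _ → (∀ b, χ.hom (a i b) = χ'.hom (a i b)) → χ = χ' := by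
    intro i χ χ' h h' heq
    refine ha0 i χ χ' h h' fun b => ?_
    simpa [a] using heq ⟨i, b⟩
  let T := {p : Spec (CommRingCat.of k) ⟶ X // p ≫ f = 𝟙 _}
  let c : Fin N → k := fun i => ((i : ℕ) : k)
  have hc : Function.Injective c := fun i j h => Fin.ext (Nat.cast_injective h)
  let e : T → Option B → k := fun p => enc (c (idx (p.1 (pt0 k)))) (a _) p.1 (hidxU _)
  have he' : ∀ (p : T) i (h : p.1 (pt0 k) ∈ U i), p.1 (pt0 k) ∉ V i → e p = enc (c i) (a i) p.1 h := by
    intro p i h h'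
    obtain rfl := huniq _ _ h h'
    rfl
  have he : Function.Injective e := by
    intro p q hpq
    have h0 : idx (p.1 (pt0 k)) = idx (q.1 (pt0 k)) := hc (congrFun hpq none)
    have hqU : q.1 (pt0 k) ∈ U (idx (p.1 (pt0 k))) := h0 ▸ hidxU _
    have hqV : q.1 (pt0 k) ∉ V (idx (p.1 (pt0 k))) := h0 ▸ hidxV _
    rw [he' q _ hqU hqV] at hpq
    exact Subtype.ext (ev_inj f (hU _) (a _) (ha _) p.1 q.1 p.2 q.2 (hidxU _) hqU
      fun b => congrFun hpq (some b))
  let g : T → T := fun p => ⟨p.1 ≫ φ, by rw [Category.assoc, hφ, p.2]⟩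
  have hg : Function.Injective g := by
    intro p q h
    exact Subtype.ext ((cancel_mono φ).1 (congrArg Subtype.val h))
  have hgpt : ∀ p : T, (g p).1 (pt0 k) = φ (p.1 (pt0 k)) := fun p => Scheme.Hom.comp_apply _ _ _
  let W : Fin N × Fin N → X.Opens := fun i => U i.1 ⊓ φ ⁻¹ᵁ U i.2
  let W' : Fin N × Fin N → X.Opens := fun i => W i ⊓ (V i.1 ⊔ φ ⁻¹ᵁ V i.2)
  have hle1 : ∀ i, W i ≤ U i.1 := fun i => inf_le_left
  have hle2 : ∀ i, W i ≤ φ ⁻¹ᵁ U i.2 := fun i => inf_le_right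
  have hle : ∀ i, W' i ≤ W i := fun i => inf_le_left
  have hgraph : {z : Option B ⊕ Option B → k | ∃ t, z = Sum.elim (e t) (e (g t))} =
      ⋃ i : Fin N × Fin N,
        img f (W i) (pairing f φ (hle1 i) (hle2 i) (c i.1) (c i.2) (a i.1) (a i.2)) \
        img f (W' i) (pairing f φ ((hle i).trans (hle1 i)) ((hle i).trans (hle2 i))
          (c i.1) (c i.2) (a i.1) (a i.2)) := by
    ext z
    simp only [Set.mem_iUnion, Set.mem_sdiff]
    constructor
    · rintro ⟨p, rfl⟩
      have hWp : p.1 (pt0 k) ∈ W (idx (p.1 (pt0 k)), idx ((g p).1 (pt0 k))) := by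
        refine ⟨hidxU _, ?_⟩
        change φ (p.1 (pt0 k)) ∈ U _
        rw [← hgpt]
        exact hidxU _
      refine ⟨(idx (p.1 (pt0 k)), idx ((g p).1 (pt0 k))), ⟨p.1, p.2, hWp, fun b => ?_⟩, ?_⟩
      · rw [ev_pairing f φ _ _ _ _ _ _ _ p.2]
      · rintro ⟨q, hq, hW', hz⟩
        have hqp : q = p.1 := by
          refine ev_inj f (hU _) (a _) (ha _) q p.1 hq p.2 (hle1 _ (hle _ hW')) (hidxU _) fun b => ?_
          have := hz (Sum.inl (some b))
          rw [ev_pairing f φ _ _ _ _ _ _ _ hq] at this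
          exact this.symm
        subst hqp
        rcases hW'.2 with h | h
        · exact hidxV _ h
        · refine hidxV ((g p).1 (pt0 k)) ?_
          rw [hgpt]
          rw [hgpt] at h
          exact h
    · rintro ⟨i, ⟨p, hp, hW, hz⟩, hn⟩
      have hpV : p (pt0 k) ∉ V i.1 ⊔ φ ⁻¹ᵁ V i.2 := by
        intro h
        refine hn ⟨p, hp, ⟨hW, h⟩, fun b => ?_⟩
        have h1 := ev_pairing f φ (hle1 i) (hle2 i) (c i.1) (c i.2) (a i.1) (a i.2) p hp hW b
        have h2 := ev_pairing f φ ((hle i).trans (hle1 i)) ((hle i).trans (hle2 i))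
          (c i.1) (c i.2) (a i.1) (a i.2) p hp ⟨hW, h⟩ b
        exact (hz b).trans (h1.trans h2.symm)
      refine ⟨⟨p, hp⟩, ?_⟩
      rw [he' ⟨p, hp⟩ i.1 (hle1 _ hW) (fun h => hpV (Or.inl h)),
        he' (g ⟨p, hp⟩) i.2 (by rw [hgpt]; exact hle2 _ hW)
          (by rw [hgpt]; exact fun h => hpV (Or.inr h))]
      funext b
      rw [hz b, ev_pairing f φ _ _ _ _ _ _ _ hp]
  have hdef : (Set.univ : Set k).Definable ring
      {z : Option B ⊕ Option B → k | ∃ t, z = Sum.elim (e t) (e (g t))} := by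
    rw [hgraph]
    exact Set.definable_iUnion_of_finite fun i =>
      (img_compact f (hcpt _) _).sdiff (img_compact f (hcpt _) _)
  obtain ⟨p, hp⟩ := AxDef.ax_definable e he g hg hdef ⟨q, hq⟩
  exact ⟨p.1, p.2, congrArg Subtype.val hp⟩

theorem isIso_of_isOpenImmersion {k : Type} [Field k] [IsAlgClosed k] [CharZero k] {X : Scheme.{0}}
    (f : X ⟶ Spec (CommRingCat.of k)) [LocallyOfFiniteType f] [QuasiCompact f]
    (φ : X ⟶ X) (hφ : φ ≫ f = f) [IsOpenImmersion φ] : IsIso φ := by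
  have hJ := LocallyOfFiniteType.jacobsonSpace f
  rw [isIso_iff_isOpenImmersion_and_surjective]
  refine ⟨inferInstance, ⟨fun x => ?_⟩⟩
  by_contra hx
  have hcl : IsClosed (Set.range φ)ᶜ := φ.isOpenEmbedding.isOpen_range.isClosed_compl
  have := JacobsonSpace.closure_inter_closedPoints hcl
  have he : (Set.range φ)ᶜ ∩ closedPoints X = ∅ := by
    rw [Set.eq_empty_iff_forall_notMem]
    rintro y ⟨hy, hyc⟩
    apply hy
    obtain ⟨p, hp⟩ := (pointEquivClosedPoint f).surjective ⟨y, hyc⟩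
    obtain ⟨r, hr, hrp⟩ := points_surjective f φ hφ p.1 p.2
    have : p.1 (pt0 k) = y := congrArg Subtype.val hp
    rw [← this, ← hrp, Scheme.Hom.comp_apply]
    exact ⟨_, rfl⟩
  rw [he, closure_empty] at this
  rw [← this] at hcl
  exact (this ▸ (show x ∈ (Set.range φ)ᶜ from hx) : x ∈ (∅ : Set X))

end AxGeom

namespace AxZmt

lemma integrallyClosed_of_affine {X : Scheme.{0}} [IsIntegral X]
    (hnormal : ∀ x : X, IsIntegrallyClosed (X.presheaf.stalk x)) {U : X.Opens}
    (hU : IsAffineOpen U) [Nonempty U] : IsIntegrallyClosed Γ(X, U) := by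
  refine IsIntegrallyClosed.of_localization_maximal fun P _ hP => ?_
  let y : PrimeSpectrum Γ(X, U) := ⟨P, hP.isPrime⟩
  have hy : hU.fromSpec y ∈ U := (hU.isoSpec.inv y).2
  let : Algebra Γ(X, U) (X.presheaf.stalk (hU.fromSpec y)) :=
    TopCat.Presheaf.algebra_section_stalk X.presheaf ⟨_, hy⟩
  have hl : IsLocalization.AtPrime (X.presheaf.stalk (hU.fromSpec y)) P :=
    hU.isLocalization_stalk' y hy
  have := hnormal (hU.fromSpec y)
  exact .of_equiv (IsLocalization.algEquiv P.primeCompl (X.presheaf.stalk (hU.fromSpec y))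
    (Localization.AtPrime P)).toRingEquiv

lemma genericPoint_map {X : Scheme.{0}} [IsIntegral X] (φ : X ⟶ X) [IsDominant φ] :
    φ (genericPoint X) = genericPoint X := by
  apply ((genericPoint_spec X).eq _).symm
  have := (genericPoint_spec X).image φ.continuous
  rw [Set.image_univ, φ.denseRange.closure_range] at this
  exact this

theorem isOpenImmersion {k : Type} [Field k] {X : Scheme.{0}} [IsIntegral X]
    (f : X ⟶ Spec (CommRingCat.of k)) [LocallyOfFiniteType f] [QuasiCompact f]
    [IsSeparated f]
    (hnormal : ∀ x : X, IsIntegrallyClosed (X.presheaf.stalk x))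
    (φ : X ⟶ X) (hφ : φ ≫ f = f)
    (hqf : ∀ y : X, (φ.base ⁻¹' {y}).Finite)
    [IsDominant φ] (hbir : IsIso (φ.stalkMap (genericPoint X))) : IsOpenImmersion φ := by
  have : LocallyOfFiniteType (φ ≫ f) := by rwa [hφ]
  have : QuasiCompact (φ ≫ f) := by rwa [hφ]
  have : IsSeparated (φ ≫ f) := by rwa [hφ]
  have : LocallyOfFiniteType φ := locallyOfFiniteType_of_comp φ f
  have : QuasiCompact φ := .of_comp φ f
  have : IsSeparated φ := .of_comp φ f
  have : LocallyQuasiFinite φ := .of_finite_preimage_singleton φ hqf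
  have h1 : IsOpenImmersion φ.toNormalization := inferInstance
  suffices h2 : IsIso φ.fromNormalization by
    rw [← φ.toNormalization_fromNormalization]; infer_instance
  have hη := genericPoint_map φ
  have key : ∀ U : X.affineOpens, IsIso (φ.fromNormalization.app U.1) := by
    rintro ⟨U, hU⟩
    rw [φ.fromNormalization_app hU]
    let := (φ.app U).hom.toAlgebra
    suffices h : IsIso (CommRingCat.ofHom (algebraMap Γ(X, U)
        (integralClosure Γ(X, U) Γ(X, φ ⁻¹ᵁ U)))) from IsIso.comp_isIso
    rw [ConcreteCategory.isIso_iff_bijective]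
    by_cases hne : Nonempty U
    swap
    · have hbot : U = ⊥ := by
        ext x; simpa using fun h => hne ⟨⟨x, h⟩⟩
      subst hbot
      have : Subsingleton Γ(X, (⊥ : X.Opens)) := inferInstance
      have : Subsingleton Γ(X, φ ⁻¹ᵁ (⊥ : X.Opens)) := inferInstanceAs (Subsingleton Γ(X, ⊥))
      exact ⟨fun _ _ _ => Subsingleton.elim (α := Γ(X, (⊥ : X.Opens))) _ _,
        fun y => ⟨0, Subtype.ext (Subsingleton.elim (α := Γ(X, φ ⁻¹ᵁ (⊥ : X.Opens))) _ _)⟩⟩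
    have hηU : genericPoint X ∈ U :=
      ((genericPoint_spec X).mem_open_set_iff U.isOpen).mpr (by simpa using hne)
    have hηU' : φ (genericPoint X) ∈ U := hη.symm ▸ hηU
    have hIC := integrallyClosed_of_affine hnormal hU
    -- fraction ring at `φ η`
    have hfrac : ∀ (x : X) (hx : x ∈ U), x = genericPoint X →
        ∀ t : X.presheaf.stalk x, (X.presheaf.germ U x hx).hom.IsIntegralElem t →
          ∃ r, X.presheaf.germ U x hx r = t := by
      rintro x hx rfl t ht
      have := functionField_isFractionRing_of_isAffineOpen X U hU
      exact (IsIntegrallyClosed.isIntegral_iff (R := Γ(X, U)) (K := X.functionField)).1 ht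
    have hcomm : ∀ r : Γ(X, U), φ.stalkMap (genericPoint X) (X.presheaf.germ U _ hηU' r) =
        X.presheaf.germ (φ ⁻¹ᵁ U) (genericPoint X) hηU' (φ.app U r) :=
      fun r => φ.germ_stalkMap_apply U (genericPoint X) hηU' r
    have hbij := ConcreteCategory.bijective_of_isIso (φ.stalkMap (genericPoint X))
    have hinjg := germ_injective_of_isIntegral (X := X) (U := φ ⁻¹ᵁ U) (genericPoint X) hηU'
    constructor
    · intro r r' h
      have h' : φ.app U r = φ.app U r' := congrArg Subtype.val h
      apply germ_injective_of_isIntegral (X := X) _ hηU'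
      apply hbij.1
      rw [hcomm, hcomm, h']
    · rintro ⟨s, hs⟩
      obtain ⟨t, ht⟩ := hbij.2 (X.presheaf.germ (φ ⁻¹ᵁ U) (genericPoint X) hηU' s)
      have htint : (X.presheaf.germ U _ hηU').hom.IsIntegralElem t := by
        obtain ⟨P, hP, hPs⟩ := hs
        refine ⟨P, hP, hbij.1 ?_⟩
        have e1 := Polynomial.hom_eval₂ P (X.presheaf.germ U _ hηU').hom
          (φ.stalkMap (genericPoint X)).hom t
        have e2 := Polynomial.hom_eval₂ P (φ.app U).hom
          (X.presheaf.germ (φ ⁻¹ᵁ U) (genericPoint X) hηU').hom s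
        have e3 : (φ.stalkMap (genericPoint X)).hom.comp (X.presheaf.germ U _ hηU').hom =
          (X.presheaf.germ (φ ⁻¹ᵁ U) (genericPoint X) hηU').hom.comp (φ.app U).hom := RingHom.ext hcomm
        have hPs' : Polynomial.eval₂ (φ.app U).hom s P = 0 := hPs
        rw [hPs', map_zero] at e2
        rw [e3] at e1
        refine e1.trans (Eq.trans ?_ (map_zero (φ.stalkMap (genericPoint X)).hom).symm)
        refine Eq.trans ?_ e2.symm
        congr 1
      obtain ⟨r, hr⟩ := hfrac _ hηU' hη t htint
      refine ⟨r, Subtype.ext (hinjg ?_)⟩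
      rw [← ht, ← hr, hcomm]
      rfl
  have : IsAffineHom φ.fromNormalization := inferInstance
  refine (IsZariskiLocalAtTarget.iff_of_iSup_eq_top (P := MorphismProperty.isomorphisms Scheme)
    (fun U : X.affineOpens => U.1) (iSup_affineOpens_eq_top X)).2 fun U => ?_
  exact (isIso_morphismRestrict_iff_isIso_app φ.fromNormalization U.2).2 (key U)
end AxZmt

/-- A quasi-finite birational endomorphism of a normal integral variety over
an algebraically closed field of characteristic zero is injective, hence an automorphism.
Normality is expressed by all local rings being integrally closed domains, and
birationality by the map on function fields (stalks at the generic point) being an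
isomorphism together with dominance. -/
theorem quasiFinite_birational_endomorphism_of_normal_injective_isAutomorphism
    (k : Type) [Field k] [IsAlgClosed k] [CharZero k]
    (X : Scheme) [IsIntegral X]
    (f : X ⟶ Spec (CommRingCat.of k)) [LocallyOfFiniteType f] [QuasiCompact f]
    [IsSeparated f]
    (hnormal : ∀ x : X, IsIntegrallyClosed (X.presheaf.stalk x))
    (φ : X ⟶ X) (hφ : φ ≫ f = f)
    (hqf : ∀ y : X, (φ.base ⁻¹' {y}).Finite)
    [IsDominant φ] (hbir : IsIso (φ.stalkMap (genericPoint X))) :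
    Function.Injective φ.base ∧ IsIso φ := by
  have h1 : IsOpenImmersion φ := AxZmt.isOpenImmersion f hnormal φ hφ hqf hbir
  exact ⟨φ.isOpenEmbedding.injective, AxGeom.isIso_of_isOpenImmersion f φ hφ⟩
end

section
/- Let φ : X → X be an endomorphism of a normal complex algebraic variety, Y a closed subvariety of codimension ≥ 2 with φ injective on X \ Y, U = X \ Y and V = X \ Z where Z = X \ φ(X \ Y). Then φ⁻¹(V) = U. -/
open AlgebraicGeometry CategoryTheory Limits
universe u

lemma aux_ring {k A K : Type u} [Field k] [CommRing A] [IsDomain A] [Field K]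
    (i : k →+* A) (hi : i.FiniteType) (j : A →+* K) (hj : Function.Injective j)
    (hjK : ∀ z : K, ∃ a b : A, b ≠ 0 ∧ z * j b = j a)
    (ψ : A →+* K) (hψ : ψ.comp i = j.comp i)
    (hψK : ∀ z : K, ∃ a b : A, ψ b ≠ 0 ∧ z * ψ b = ψ a) :
    Function.Injective ψ := by
  algebraize [i, j, j.comp i]
  have : FaithfulSMul A K := (faithfulSMul_iff_algebraMap_injective A K).mpr hj
  have hjalg : Algebra.IsAlgebraic A K := by
    refine ⟨fun z => ?_⟩
    obtain ⟨a, b, hb, h⟩ := hjK z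
    refine ⟨Polynomial.C b * Polynomial.X - Polynomial.C a, ?_, ?_⟩
    · intro h0
      apply hb
      have := congrArg (fun p => Polynomial.coeff p 1) h0
      simpa [Polynomial.coeff_C] using this
    · simp only [map_sub, map_mul, Polynomial.aeval_C, Polynomial.aeval_X]
      rw [mul_comm]; exact sub_eq_zero.mpr h
  let Ψ : A →ₐ[k] K := { ψ with commutes' := fun r => congrArg (fun f => f r) hψ }
  have hΨ : ∀ a, Ψ a = ψ a := fun _ => rfl
  have halg2 : Algebra.IsAlgebraic Ψ.range K := by
    refine ⟨fun z => ?_⟩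
    obtain ⟨a, b, hb, h⟩ := hψK z
    refine ⟨Polynomial.C (⟨Ψ b, b, rfl⟩ : Ψ.range) * Polynomial.X -
      Polynomial.C (⟨Ψ a, a, rfl⟩ : Ψ.range), ?_, ?_⟩
    · intro h0
      apply hb
      rw [← hΨ]
      have := congrArg (fun p => Polynomial.coeff p 1) h0
      simpa [Polynomial.coeff_C, Subtype.ext_iff] using this
    · simp only [map_sub, map_mul, Polynomial.aeval_C, Polynomial.aeval_X]
      rw [mul_comm]; exact sub_eq_zero.mpr h
  have : FaithfulSMul k K := inferInstance
  have : FaithfulSMul k Ψ.range := (faithfulSMul_iff_algebraMap_injective k Ψ.range).mpr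
    (algebraMap k Ψ.range).injective
  have hfin : Algebra.trdeg k A < Cardinal.aleph0 := trdeg_lt_aleph0_of_finiteType
  obtain ⟨s, hs⟩ := exists_isTranscendenceBasis k Ψ.range
  have e1 : Algebra.trdeg k Ψ.range = Algebra.trdeg k K := by
    rw [← _root_.trdeg_add_eq k Ψ.range (A := K), trdeg_eq_zero (R := Ψ.range) (A := K), add_zero]
  have e2 : Algebra.trdeg k A = Algebra.trdeg k K := by
    rw [← _root_.trdeg_add_eq k A (A := K), trdeg_eq_zero (R := A) (A := K), add_zero]
  choose y hy using fun t : s => t.1.2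
  have hyind : AlgebraicIndependent k y := by
    have : AlgebraicIndependent k (Ψ.rangeRestrict ∘ y) := by
      convert hs.1 using 1
      ext t; exact hy t
    exact AlgebraicIndependent.of_comp _ this
  have hyb : IsTranscendenceBasis k y := by
    apply hyind.isTranscendenceBasis_of_trdeg_le hfin
    rw [e2, ← e1, hs.cardinalMk_eq_trdeg]
  have hyalg := hyb.isAlgebraic
  rw [injective_iff_map_eq_zero]
  intro a ha
  by_contra ha0
  have := Ideal.comap_ne_bot_of_algebraic_mem (R := Algebra.adjoin k (Set.range y))
    (I := RingHom.ker ψ) ha0 ha (hyalg.isAlgebraic a)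
  apply this
  rw [eq_bot_iff]
  rintro ⟨b, hb⟩ hb'
  rw [Algebra.adjoin_range_eq_range_aeval] at hb
  obtain ⟨p, rfl⟩ := hb
  have h0 : Ψ (MvPolynomial.aeval y p) = 0 := hb'
  have h1 : AlgebraicIndependent k (Ψ ∘ y) := by
    have := hs.1.map' (f := Ψ.range.val) Subtype.val_injective
    convert this using 1
    ext t; exact hy t
  have hp : p = 0 := by
    apply h1.eq_zero_of_aeval_eq_zero
    rw [← h0]
    exact (MvPolynomial.comp_aeval_apply y Ψ p).symm
  simp only [hp, map_zero]
  rfl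

lemma aux_univInj {K : Type u} [Field K] [IsAlgClosed K] {U X : Scheme.{u}}
    (f : X ⟶ Spec (CommRingCat.of K)) [LocallyOfFiniteType f]
    (g : U ⟶ X) [LocallyOfFiniteType g] [IsSeparated g] (hg : Function.Injective g) :
    UniversallyInjective g := by
  rw [UniversallyInjective.iff_diagonal]
  let P := pullback g g
  let h : P ⟶ Spec (CommRingCat.of K) := pullback.fst g g ≫ g ≫ f
  have : JacobsonSpace P := LocallyOfFiniteType.jacobsonSpace h
  have hcl : IsClosed (Set.range (pullback.diagonal g)) :=
    (pullback.diagonal g).isClosedEmbedding.isClosed_range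
  have key : closedPoints P ⊆ Set.range (pullback.diagonal g) := by
    intro x hx
    have hx' : IsClosed {x} := hx
    let p := pointOfClosedPoint h x hx'
    have hp : p ≫ h = 𝟙 _ := pointOfClosedPoint_comp h x hx'
    have e : p ≫ pullback.fst g g = p ≫ pullback.snd g g := by
      apply ext_of_apply_closedPoint_eq (g ≫ f)
      · simpa [h] using hp
      · simpa [h, ← pullback.condition_assoc] using hp
      · apply hg
        refine (Scheme.Hom.comp_apply _ _ _).symm.trans (Eq.trans ?_ (Scheme.Hom.comp_apply _ _ _))
        simp only [Category.assoc, pullback.condition]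
    refine ⟨(p ≫ pullback.fst g g) (IsLocalRing.closedPoint K), ?_⟩
    refine (Scheme.Hom.comp_apply _ _ _).symm.trans ?_
    have : (p ≫ pullback.fst g g) ≫ pullback.diagonal g = p := by
      apply pullback.hom_ext <;> simp [e]
    rw [this]
    exact pointOfClosedPoint_apply h x hx' _
  refine ⟨Set.range_eq_univ.mp (Set.eq_univ_of_univ_subset ?_)⟩
  have := closure_closedPoints (X := P)
  rw [← this]
  exact hcl.closure_subset_iff.mpr key

/-- final step -/
lemma aux_final {X : Scheme.{u}} [IrreducibleSpace X] (φ : X ⟶ X) [IsSeparated φ] (U : X.Opens)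
   (hne : (U : Set X).Nonempty) [IsOpenImmersion (U.ι ≫ φ)] : φ ⁻¹' (φ '' (U : Set X)) = U := by
  let V := (U.ι ≫ φ).opensRange
  have hV : (V : Set X) = φ '' U := by
    simp [V, Scheme.Hom.coe_opensRange, Set.range_comp]
  have hUV : U ≤ φ ⁻¹ᵁ V := by
    intro x hx
    exact ⟨⟨x, hx⟩, rfl⟩
  let s : U.toScheme ⟶ (φ ⁻¹ᵁ V) := X.homOfLE hUV
  have : IsIso (s ≫ φ ∣_ V) := by
    have e : s ≫ φ ∣_ V = (Scheme.Hom.isoOpensRange (U.ι ≫ φ)).hom := by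
      rw [← cancel_mono V.ι]
      simp [s, V]
    rw [e]; infer_instance
  have : IsClosedImmersion s := .of_comp s (φ ∣_ V)
  have hcl := s.isClosedEmbedding.isClosed_range
  obtain ⟨C, hC, hC'⟩ := isClosed_induced_iff.mp hcl
  have hr : ∀ x (hx : x ∈ φ ⁻¹ᵁ V), x ∈ C ↔ x ∈ U := by
    intro x hx
    have := Set.ext_iff.mp hC' ⟨x, hx⟩
    refine this.trans ?_
    constructor
    · rintro ⟨y, hy⟩
      have := congrArg (φ ⁻¹ᵁ V).ι hy
      rw [← Scheme.Hom.comp_apply] at this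
      simp [s] at this
      exact this ▸ y.2
    · intro h
      refine ⟨⟨x, h⟩, (φ ⁻¹ᵁ V).ι.injective ?_⟩
      refine (Scheme.Hom.comp_apply _ _ _).symm.trans ?_
      simp only [s, Scheme.homOfLE_ι]
      rfl
  have hCuniv : C = Set.univ := by
    have hd : Dense (U : Set X) := U.isOpen.dense hne
    have : (U : Set X) ⊆ C := fun x hx => (hr x (hUV hx)).mpr hx
    rw [← hC.closure_eq]
    exact (hd.mono this).closure_eq
  rw [← hV]
  ext x
  constructor
  · intro hx
    exact (hr x hx).mp (hCuniv ▸ Set.mem_univ _)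
  · intro hx
    exact hUV hx

lemma aux_quot {U X : Scheme.{u}} [IsIntegral U] (h : U ⟶ X) (W : X.Opens) (hW : IsAffineOpen W)
    (hη : h (genericPoint U) ∈ W) (hs : Function.Surjective (h.stalkMap (genericPoint U))) 
    (z : U.functionField) :
    ∃ a b : Γ(X, W), (X.presheaf.germ W _ hη ≫ h.stalkMap (genericPoint U)).hom b ≠ (0 : U.functionField) ∧
    z * (X.presheaf.germ W _ hη ≫ h.stalkMap (genericPoint U)).hom b =
      (X.presheaf.germ W _ hη ≫ h.stalkMap (genericPoint U)).hom a := by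
  obtain ⟨z', hz'⟩ := hs z
  have hloc := hW.isLocalization_stalk ⟨_, hη⟩
  let := X.presheaf.algebra_section_stalk ⟨_, hη⟩
  obtain ⟨⟨a, s⟩, h1⟩ := IsLocalization.surj (hW.primeIdealOf ⟨_, hη⟩).asIdeal.primeCompl z'
  have hu := IsLocalization.map_units (X.presheaf.stalk (h (genericPoint U))) s
  refine ⟨a, s.1, ?_, ?_⟩
  · have := (hu.map (h.stalkMap (genericPoint U)).hom)
    exact IsUnit.ne_zero (M₀ := U.functionField) this
  · rw [← hz']
    have := congrArg (h.stalkMap (genericPoint U)).hom h1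
    rw [map_mul] at this
    exact this

lemma aux_compat {S U X : Scheme.{u}} (f : X ⟶ S) (h : U ⟶ X) (η : U) (W : X.Opens)
    (hη : h η ∈ W) (e : W ≤ f ⁻¹ᵁ ⊤) :
    f.appLE ⊤ W e ≫ X.presheaf.germ W _ hη ≫ h.stalkMap η =
    (h ≫ f).appTop ≫ U.presheaf.germ ⊤ η trivial := by
  rw [Scheme.Hom.germ_stalkMap, h.app_eq_appLE, Scheme.Hom.appLE_comp_appLE_assoc]
  simp only [Scheme.Hom.appLE, Scheme.Hom.appTop, Category.assoc]
  exact congrArg (fun t => Scheme.Hom.app (h ≫ f) ⊤ ≫ t)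
    (TopCat.Presheaf.germ_res U.presheaf (homOfLE _) η hη)

lemma aux_charZero {R : Type u} [Field R] (φ : ℂ →+* R) : CharZero R :=
  charZero_of_injective_ringHom φ.injective

lemma aux_surj {U X : Scheme.{0}} [IsIntegral U]
    (f : X ⟶ Spec (CommRingCat.of ℂ)) (g : U ⟶ X) [UniversallyInjective g] :
    Function.Surjective (g.stalkMap (genericPoint U)) := by
  have h3 := ((tfae_universallyInjective g).out 0 2).mp ‹_›
  have hp := h3.2 (genericPoint U)
  have hsurj : Function.Surjective (g.residueFieldMap (genericPoint U)).hom := by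
    let x := g (genericPoint U)
    have : CharZero (X.residueField x) :=
      aux_charZero (Spec.preimage (X.fromSpecResidueField x ≫ f)).hom
    algebraize [(g.residueFieldMap (genericPoint U)).hom]
    have : IsPurelyInseparable (X.residueField x) (U.residueField (genericPoint U)) := hp
    exact IsPurelyInseparable.surjective_algebraMap_of_isSeparable (X.residueField x) (U.residueField (genericPoint U))
  intro z
  obtain ⟨w, hw⟩ := hsurj (U.residue _ z)
  obtain ⟨v, hv⟩ := X.residue_surjective _ w
  refine ⟨v, ?_⟩
  have hinj : Function.Injective (U.residue (genericPoint U)).hom :=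
    RingHom.injective (R := U.functionField) (U.residue (genericPoint U)).hom
  apply hinj
  have e := congrArg (fun t => t.hom v) (Scheme.residue_residueFieldMap g (genericPoint U))
  rw [← hv] at hw
  exact e.symm.trans hw


lemma aux_int {A B K : Type u} [CommRing A] [IsDomain A] [IsIntegrallyClosed A] [CommRing B] [Field K]
    [Algebra A B] (β : B →+* K) (hβ : Function.Injective β)
    (hψ : Function.Injective (β.comp (algebraMap A B)))
    (hψK : ∀ z : K, ∃ a b : A, β (algebraMap A B b) ≠ 0 ∧
      z * β (algebraMap A B b) = β (algebraMap A B a)) :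
    Function.Bijective (algebraMap A (integralClosure A B)) := by
  constructor
  · intro a b h
    apply hψ
    exact congrArg (fun t : integralClosure A B => β t.1) h
  · rintro ⟨b, hb⟩
    algebraize [β, β.comp (algebraMap A B)]
    have : IsFractionRing A K := by
      refine (isLocalization_iff _ _).mpr ⟨?_, ?_, ?_⟩
      · rintro ⟨y, hy⟩
        apply IsUnit.mk0
        intro h
        exact nonZeroDivisors.ne_zero hy (hψ (h.trans (map_zero _).symm))
      · intro z
        obtain ⟨a, b, hb, h⟩ := hψK z
        refine ⟨⟨a, b, ?_⟩, h⟩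
        apply mem_nonZeroDivisors_of_ne_zero
        rintro rfl
        exact hb (by simp)
      · intro x y h
        exact ⟨1, by rw [hψ h]⟩
    have hb' : IsIntegral A (algebraMap B K b) := hb.algebraMap
    obtain ⟨a, ha⟩ := IsIntegrallyClosed.isIntegral_iff.mp hb'
    exact ⟨a, Subtype.ext (hβ ha)⟩

lemma aux_normal {X : Scheme.{u}} [IsIntegral X]
    (hnormal : ∀ x : X, IsIntegrallyClosed (X.presheaf.stalk x)) (W : X.Opens) [Nonempty W]
    (hW : IsAffineOpen W) : IsIntegrallyClosed Γ(X, W) := by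
  refine IsIntegrallyClosed.of_localization_maximal fun p _ hp => ?_
  have hy : hW.fromSpec ⟨p, hp.isPrime⟩ ∈ W := by
    have : hW.fromSpec ⟨p, hp.isPrime⟩ ∈ Set.range hW.fromSpec := ⟨_, rfl⟩
    rw [hW.range_fromSpec] at this; exact this
  let := X.presheaf.algebra_section_stalk ⟨_, hy⟩
  have := hW.isLocalization_stalk' ⟨p, hp.isPrime⟩ hy
  have := hnormal (hW.fromSpec ⟨p, hp.isPrime⟩)
  have : IsLocalization p.primeCompl (X.presheaf.stalk (hW.fromSpec ⟨p, hp.isPrime⟩)) := by assumption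
  let e := IsLocalization.algEquiv p.primeCompl (X.presheaf.stalk (hW.fromSpec ⟨p, hp.isPrime⟩)) (Localization.AtPrime p)
  exact IsIntegrallyClosed.of_equiv e.toRingEquiv

lemma aux_isoNorm {U X : Scheme.{u}} (g : U ⟶ X) [QuasiCompact g] [QuasiSeparated g]
    (h : ∀ W : X.Opens, IsAffineOpen W → letI := (g.app W).hom.toAlgebra
      Function.Bijective (algebraMap Γ(X, W) (integralClosure Γ(X, W) Γ(U, g ⁻¹ᵁ W)))) :
    IsIso g.fromNormalization := by
  change MorphismProperty.isomorphisms Scheme g.fromNormalization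
  rw [IsZariskiLocalAtTarget.iff_of_iSup_eq_top (P := MorphismProperty.isomorphisms Scheme) _
    (iSup_affineOpens_eq_top X)]
  intro W
  have : IsAffine W.1.toScheme := W.2
  have : IsAffine (g.fromNormalization ⁻¹ᵁ W.1).toScheme := W.2.preimage g.fromNormalization
  suffices hh : IsIso (g.fromNormalization ∣_ W.1).appTop from
    (MorphismProperty.arrow_mk_iso_iff (MorphismProperty.isomorphisms _)
      (arrowIsoSpecΓOfIsAffine (g.fromNormalization ∣_ W.1))).mpr
      (inferInstanceAs (IsIso (Spec.map ((g.fromNormalization ∣_ W.1).appTop))))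
  have : IsIso (g.fromNormalization.app W) := by
    rw [g.fromNormalization_app W.2]
    have : IsIso (CommRingCat.ofHom (letI := (g.app W).hom.toAlgebra; algebraMap Γ(X, W) (integralClosure Γ(X, W) Γ(U, g ⁻¹ᵁ W)))) := by
      rw [ConcreteCategory.isIso_iff_bijective]
      exact h W.1 W.2
    exact IsIso.comp_isIso
  rw [Scheme.Hom.appTop, morphismRestrict_app]
  have hmap : ∀ (A B : g.normalization.Opens) (h : A = B),
      IsIso (g.normalization.presheaf.map (eqToHom h).op) := by
    rintro A _ rfl; infer_instance
  have hall : ∀ W' : X.Opens, W' = W.1 → IsIso (g.fromNormalization.app W') := by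
    rintro W' rfl; assumption
  exact @IsIso.comp_isIso _ _ _ _ _ _ _ (hall (W.1.ι ''ᵁ ⊤) (by simp)) (hmap _ _ _)

lemma aux_genInj {X : Scheme.{0}} [IsIntegral X] (f : X ⟶ Spec (CommRingCat.of ℂ))
    [LocallyOfFiniteType f] (U : X.Opens) [Nonempty U] (g : U.toScheme ⟶ X) (hg : g ≫ f = U.ι ≫ f)
    [UniversallyInjective g] (W : X.Opens) (hW : IsAffineOpen W)
    (hη : g (genericPoint U) ∈ W) :
    Function.Injective (X.presheaf.germ W _ hη ≫ g.stalkMap (genericPoint U)).hom := by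
  have hsurjg := aux_surj f g
  have : Nonempty W := ⟨⟨_, hη⟩⟩
  have hιη : U.ι (genericPoint U) ∈ W := by
    rw [genericPoint_eq_of_isOpenImmersion U.ι]
    exact ((genericPoint_spec X).mem_open_set_iff W.isOpen).mpr (by
      rw [Set.univ_inter]; exact ⟨_, hη⟩)
  have hsι : Function.Surjective (U.ι.stalkMap (genericPoint U)) :=
    ((ConcreteCategory.isIso_iff_bijective (U.ι.stalkMap (genericPoint U))).mp inferInstance).2
  have hiι : Function.Injective (U.ι.stalkMap (genericPoint U)) :=
    ((ConcreteCategory.isIso_iff_bijective (U.ι.stalkMap (genericPoint U))).mp inferInstance).1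
  have hj : Function.Injective
      (X.presheaf.germ W _ hιη ≫ U.ι.stalkMap (genericPoint U)).hom := by
    intro a b h
    exact germ_injective_of_isIntegral X _ hιη (hiι h)
  have hfin : (f.appLE ⊤ W le_top).hom.FiniteType :=
    f.finiteType_appLE (isAffineOpen_top _) hW le_top
  refine aux_ring (k := ℂ) (A := Γ(X, W)) (K := U.toScheme.functionField)
    ((Scheme.ΓSpecIso (CommRingCat.of ℂ)).inv ≫ f.appLE ⊤ W le_top).hom ?_
    (X.presheaf.germ W _ hιη ≫ U.ι.stalkMap (genericPoint U)).hom hj ?_ _ ?_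
    (aux_quot g W hW hη hsurjg)
  · rw [CommRingCat.hom_comp]
    refine hfin.comp ?_
    exact RingHom.FiniteType.of_surjective _
      ((ConcreteCategory.isIso_iff_bijective (Scheme.ΓSpecIso (CommRingCat.of ℂ)).inv).mp inferInstance).2
  · intro z
    obtain ⟨a, b, hb, h⟩ := aux_quot U.ι W hW hιη hsι z
    refine ⟨a, b, ?_, h⟩
    rintro rfl
    exact hb (map_zero _)
  · rw [← CommRingCat.hom_comp, ← CommRingCat.hom_comp, Category.assoc, Category.assoc]
    have e1 := aux_compat f g (genericPoint U) W hη le_top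
    have e2 := aux_compat f U.ι (genericPoint U) W hιη le_top
    rw [e1, e2, hg]

lemma aux_generic {X : Scheme.{0}} [IsIntegral X] (f : X ⟶ Spec (CommRingCat.of ℂ))
    [LocallyOfFiniteType f] (U : X.Opens) [Nonempty U] (g : U.toScheme ⟶ X) (hg : g ≫ f = U.ι ≫ f)
    [UniversallyInjective g] (O : X.Opens) (hO : (O : Set X).Nonempty) :
    g (genericPoint U) ∈ O := by
  obtain ⟨_, ⟨W, hW, rfl⟩, hη, -⟩ := X.isBasis_affineOpens.exists_subset_of_mem_open
    (Set.mem_univ (g (genericPoint U))) isOpen_univ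
  have hinj := aux_genInj f U g hg W hW hη
  obtain ⟨x, hxO, hxW⟩ : ((O : Set X) ∩ W).Nonempty :=
    nonempty_preirreducible_inter O.isOpen W.isOpen hO ⟨_, hη⟩
  obtain ⟨a, ha, hxa⟩ := hW.exists_basicOpen_le ⟨x, hxO⟩ hxW
  apply ha
  rw [X.mem_basicOpen _ _ hη]
  by_contra hnu
  have h0 : (g.stalkMap (genericPoint U)).hom (X.presheaf.germ W _ hη a) = 
      (0 : U.toScheme.functionField) := by
    by_contra hne
    have : IsUnit ((g.stalkMap (genericPoint U)).hom (X.presheaf.germ W _ hη a)) :=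
      IsUnit.mk0 (G₀ := U.toScheme.functionField) _ hne
    exact hnu (isUnit_of_map_unit (g.stalkMap (genericPoint U)).hom _ this)
  have ha0 : a = 0 := hinj (h0.trans (map_zero _).symm)
  subst ha0
  simp at hxa

lemma aux_openImm {X : Scheme.{0}} [IsIntegral X] (f : X ⟶ Spec (CommRingCat.of ℂ))
    [LocallyOfFiniteType f] (hnormal : ∀ x : X, IsIntegrallyClosed (X.presheaf.stalk x))
    (U : X.Opens) [Nonempty U] (g : U.toScheme ⟶ X) (hg : g ≫ f = U.ι ≫ f)
    [UniversallyInjective g] [LocallyOfFiniteType g] [IsSeparated g] [QuasiCompact g] :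
    IsOpenImmersion g := by
  have : IsIso g.fromNormalization := by
    apply aux_isoNorm
    intro W hW
    obtain hWe | hWn := (W : Set X).eq_empty_or_nonempty
    · obtain rfl : W = ⊥ := by ext1; exact hWe
      have : Subsingleton Γ(X, ⊥) := inferInstance
      have : Subsingleton Γ(U, g ⁻¹ᵁ ⊥) := inferInstanceAs (Subsingleton Γ(U, ⊥))
      let := (g.app ⊥).hom.toAlgebra
      exact ⟨fun _ _ _ => Subsingleton.elim _ _, fun b => ⟨0, Subsingleton.elim _ _⟩⟩
    · have hη := aux_generic f U g hg W hWn
      have hinj := aux_genInj f U g hg W hW hη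
      have : Nonempty W := hWn.to_subtype
      have := aux_normal hnormal W hW
      have hηU : genericPoint U ∈ g ⁻¹ᵁ W := hη
      have e : X.presheaf.germ W _ hη ≫ g.stalkMap (genericPoint U) =
        g.app W ≫ U.toScheme.presheaf.germ (g ⁻¹ᵁ W) (genericPoint U) hηU := 
        Scheme.Hom.germ_stalkMap _ _ _ _
      let := (g.app W).hom.toAlgebra
      refine aux_int (K := U.toScheme.functionField)
        (U.toScheme.presheaf.germ (g ⁻¹ᵁ W) (genericPoint U) hηU).hom
        (germ_injective_of_isIntegral _ _ _) ?_ ?_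
      · rw [e] at hinj; exact hinj
      · have := aux_quot g W hW hη (aux_surj f g)
        rw [e] at this; exact this
  rw [← g.toNormalization_fromNormalization]
  infer_instance

open AlgebraicGeometry CategoryTheory

/-- Let `φ` be an endomorphism of a normal complex algebraic variety `X`,
`Y` a closed subvariety of codimension at least 2 with `φ` injective on `U = X \ Y`, and
`V = X \ Z` where `Z = X \ φ(X \ Y)`. Then `φ⁻¹(V) = U`. -/
theorem preimage_of_image_open_eq_complement
    (X : Scheme) [IsIntegral X]
    (f : X ⟶ Spec (CommRingCat.of ℂ)) [LocallyOfFiniteType f] [QuasiCompact f]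
    [IsSeparated f]
    (hnormal : ∀ x : X, IsIntegrallyClosed (X.presheaf.stalk x))
    (φ : X ⟶ X) (hφ : φ ≫ f = f)
    (Y : Set X) (hYcl : IsClosed Y) (hYirr : IsIrreducible Y)
    (hcodim : topologicalKrullDim Y + 2 ≤ topologicalKrullDim X)
    (U : Set X) (hU : U = Yᶜ)
    (hinj : Set.InjOn φ.base U)
    (Z V : Set X) (hZ : Z = (Set.univ : Set X) \ φ.base '' U) (hV : V = Zᶜ) :
    φ.base ⁻¹' V = U := by
  have hV' : V = φ.base '' U := by
    rw [hV, hZ, ← Set.compl_eq_univ_sdiff, compl_compl]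
  rw [hV']
  obtain rfl | hne := U.eq_empty_or_nonempty
  · simp
  have hUo : IsOpen U := hU ▸ hYcl.isOpen_compl
  let Uo : X.Opens := ⟨U, hUo⟩
  have : Nonempty Uo := hne.to_subtype
  have : LocallyOfFiniteType (φ ≫ f) := by rw [hφ]; infer_instance
  have : IsSeparated (φ ≫ f) := by rw [hφ]; infer_instance
  have : LocallyOfFiniteType φ := locallyOfFiniteType_of_comp φ f
  have : IsSeparated φ := IsSeparated.of_comp φ f
  have : IsLocallyNoetherian X := LocallyOfFiniteType.isLocallyNoetherian f
  have : CompactSpace X := QuasiCompact.compactSpace_of_compactSpace f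
  have : IsNoetherian X := { }
  have : QuasiCompact (Uo.ι ≫ φ) := inferInstance
  have hginj : Function.Injective (Uo.ι ≫ φ) := by
    intro x y h
    exact Subtype.ext (hinj x.2 y.2 h)
  have : UniversallyInjective (Uo.ι ≫ φ) := aux_univInj f _ hginj
  have : IsOpenImmersion (Uo.ι ≫ φ) :=
    aux_openImm f hnormal Uo (Uo.ι ≫ φ) (by rw [Category.assoc, hφ])
  exact aux_final φ Uo hne
end
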